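/- Fix γ > 1 and 1 < β < γ. For every vertex z on the main part of a branch of order 1 of the configuration η = η(γ), the β-biased random walk Z_t = (X_t,Y_t) started at z on η satisfies lim_{t→∞} X_t/t = 0 almost surely; indeed, writing U(x) for the first time the walk reaches x-coordinate x, almost surely lim_{x→∞} U(x)/x = ∞. -/

import Mathlib

open MeasureTheory Filter
open scoped ENNReal

noncomputable section

/-- Vertices of the square lattice. -/
abbrev V : Type := ℤ × ℤ

/-- Adjacency in the square lattice ℤ²: Euclidean distance one. -/
def latAdj (u v : V) : Prop := (u.1 - v.1) ^ 2 + (u.2 - v.2) ^ 2 = 1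

instance : MeasurableSpace (Sym2 V) := ⊤

open scoped Classical in
/-- One-step transition probability of the β-biased random walk on the subgraph of ℤ²
with edge set `G`: if the set `Λ` of neighbours of `z` is nonempty and contains the right
neighbour `(z.1+1, z.2)`, step to it with probability `β/(β+|Λ|-1)` and to each other
neighbour with probability `1/(β+|Λ|-1)`; if `Λ` does not contain the right neighbour, step
uniformly in `Λ`; if `Λ` is empty, stay put. -/
def transProb (β : ℝ) (G : Set (Sym2 V)) (z w : V) : ℝ :=
  if {u : V | s(z, u) ∈ G} = ∅ then (if w = z then 1 else 0)
  else
    if s(z, w) ∈ G then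
      (if s(z, ((z.1 + 1, z.2) : V)) ∈ G then
        (if w = ((z.1 + 1, z.2) : V) then
          β / (β + ({u : V | s(z, u) ∈ G}.ncard : ℝ) - 1)
        else 1 / (β + ({u : V | s(z, u) ∈ G}.ncard : ℝ) - 1))
      else 1 / ({u : V | s(z, u) ∈ G}.ncard : ℝ))
    else 0

/-- `μ` is the law of the β-biased random walk on the subgraph of ℤ² with edge set `G`,
started at `z₀`: a probability measure on trajectories whose cylinder probabilities are
the products of the one-step transition probabilities. -/
def IsWalkLaw (β : ℝ) (G : Set (Sym2 V)) (z₀ : V) (μ : Measure (ℕ → V)) : Prop :=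
  IsProbabilityMeasure μ ∧
    ∀ (n : ℕ) (f : ℕ → V), f 0 = z₀ →
      μ {ω | ∀ i ≤ n, ω i = f i} =
        ENNReal.ofReal (∏ i ∈ Finset.range n, transProb β G (f i) (f (i + 1)))

/-- The trap with anchor `(d, y)`, entrance length `e` (at height `y+1`, running leftward
from the anchor) and core length `c` (at height `y+2`, running rightward). -/
def trapEdgesAt (d y : ℤ) (e c : ℕ) : Set (Sym2 V) :=
  {s((d, y), (d, y + 1)), s((d - e, y + 1), (d - e, y + 2))} ∪
    {f | ∃ i : ℕ, i < e ∧ f = s((d - e + i, y + 1), (d - e + i + 1, y + 1))} ∪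
    {f | ∃ i : ℕ, i < c ∧ f = s((d - e + i, y + 2), (d - e + i + 1, y + 2))}

/-- `b_k = 4 · 3^{k(k-1)/2}`. -/
def bF (k : ℕ) : ℕ := 4 * 3 ^ (k * (k - 1) / 2)

/-- `q_k = 3^k - 1`. -/
def qF (k : ℕ) : ℕ := 3 ^ k - 1

open scoped Classical in
/-- Direction of the abutment of a branch on row index `l` (odd): `+1` if `(l+1)/2` is odd
(so that the root lands on a row reserved for branches of the next order), `-1` otherwise. -/
def dirF (l : ℤ) : ℤ := if Odd ((l + 1) / 2) then 1 else -1

/-- The set of x-coordinates of tips of order-`k` branches of the fractal configuration: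
`0` is a tip of every order, and if `x` is an order-`(k+1)` tip then `x + (j-1)·b_k` is an
order-`k` tip for every `1 ≤ j ≤ q_k` (the order-`k` branches attached to the order-`(k+1)`
branch with tip `x` have their roots at `x + j·b_k - 1`, hence their tips at `x + (j-1)·b_k`). -/
inductive IsTip : ℕ → ℤ → Prop
  | zero (k : ℕ) : IsTip k 0
  | step (k : ℕ) (x : ℤ) (j : ℕ) : IsTip (k + 1) x → 1 ≤ j → j ≤ qF k →
      IsTip k (x + ((j : ℤ) - 1) * (bF k : ℤ))

/-- The y-coordinate of the row with index `l` reserved for order-`k` branches: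
`y = 3 · 2^{k-1} · l` (`l` odd). -/
def rowY (k : ℕ) (l : ℤ) : ℤ := 3 * 2 ^ (k - 1) * l

/-- The fractal configuration ξ: for every order `k ≥ 1`, every odd `l` and every order-`k`
tip `x`, the main part of the branch (the `b_k - 1` horizontal edges from the tip
`(x, 3·2^{k-1}·l)` to the corner `(x + b_k - 1, 3·2^{k-1}·l)`) together with its abutment
(the `3·2^{k-1}` vertical edges from the corner to the root, in the direction `dirF l`). -/
def xiEdges : Set (Sym2 V) :=
  {f | ∃ (k : ℕ) (l x : ℤ), 1 ≤ k ∧ Odd l ∧ IsTip k x ∧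
    ((∃ i : ℕ, i + 2 ≤ bF k ∧
        f = s((x + i, rowY k l), (x + i + 1, rowY k l))) ∨
      (∃ j : ℕ, j < 3 * 2 ^ (k - 1) ∧
        f = s((x + bF k - 1, rowY k l + dirF l * j),
              (x + bF k - 1, rowY k l + dirF l * (j + 1)))))}

/-- `z` lies on the main part of the order-`k` branch with row index `l` and tip
x-coordinate `x`. -/
def OnMainPart (k : ℕ) (l x : ℤ) (z : V) : Prop :=
  z.2 = rowY k l ∧ x ≤ z.1 ∧ z.1 ≤ x + bF k - 1

/-- Core length of the trap attached to an order-`k` branch: `c_k = 3^{(k-1)(k-2)/2}`. -/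
def cF (k : ℕ) : ℕ := 3 ^ ((k - 1) * (k - 2) / 2)

/-- Entrance length of the trap attached to an order-`k` branch:
`e_k = min{⌈log k / log γ⌉, 3^{(k-1)(k-2)/2}}`. -/
def eF (γ : ℝ) (k : ℕ) : ℕ := min ⌈Real.log k / Real.log γ⌉₊ (cF k)

/-- The x-coordinate of the anchor of the trap attached to the order-`k` branch with tip
x-coordinate `x`: `2 · 3^{(k-1)(k-2)/2}` steps to the left of the corner. -/
def anchorX (k : ℕ) (x : ℤ) : ℤ := x + bF k - 1 - 2 * (cF k : ℤ)

/-- The trap attached to the order-`k` branch with row index `l` and tip x-coordinate `x`. -/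
def branchTrap (γ : ℝ) (k : ℕ) (l x : ℤ) : Set (Sym2 V) :=
  trapEdgesAt (anchorX k x) (rowY k l) (eF γ k) (cF k)

/-- The configuration η = η(γ): the fractal configuration ξ with one trap attached to each
branch of order `k ≥ 2`. -/
def etaEdges (γ : ℝ) : Set (Sym2 V) :=
  xiEdges ∪
    {f | ∃ (k : ℕ) (l x : ℤ), 2 ≤ k ∧ Odd l ∧ IsTip k x ∧ f ∈ branchTrap γ k l x}

/-- First time the walk reaches x-coordinate `a` (with value `⊤` if it never does). -/
def hitTimeX (ω : ℕ → V) (a : ℤ) : ℕ∞ :=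
  sInf {n : ℕ∞ | ∃ t : ℕ, (t : ℕ∞) = n ∧ (ω t).1 = a}

/-- The cylinder of trajectories that agree with `f` up to time `n`. -/
def cyl (n : ℕ) (f : ℕ → V) : Set (ℕ → V) := {ω | ∀ i ≤ n, ω i = f i}

lemma transProb_nonneg {β : ℝ} (hβ : 1 < β) (G : Set (Sym2 V)) (z w : V) :
    0 ≤ transProb β G z w := by
  have hn : (0 : ℝ) ≤ ({u : V | s(z, u) ∈ G}.ncard : ℝ) := Nat.cast_nonneg _
  unfold transProb
  split_ifs <;> first | positivity | (apply div_nonneg <;> linarith)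

lemma measure_cyl_update {β : ℝ} (hβ : 1 < β) {G : Set (Sym2 V)} {z : V}
    {μ : Measure (ℕ → V)} (hμ : IsWalkLaw β G z μ) (n : ℕ) (f : ℕ → V) (hf : f 0 = z) (w : V) :
    μ (cyl (n + 1) (Function.update f (n + 1) w)) =
      μ (cyl n f) * ENNReal.ofReal (transProb β G (f n) w) := by
  have h1 := hμ.2 (n + 1) (Function.update f (n + 1) w) (by simpa using hf)
  have h2 := hμ.2 n f hf
  unfold cyl
  rw [h1, h2, Finset.prod_range_succ, ENNReal.ofReal_mul
    (Finset.prod_nonneg fun i _ => transProb_nonneg hβ G _ _)]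
  congr 2
  · refine Finset.prod_congr rfl fun i hi => ?_
    have hi := Finset.mem_range.1 hi
    rw [Function.update_of_ne (by omega), Function.update_of_ne (by omega)]
  · rw [Function.update_of_ne (by omega), Function.update_self]

lemma measure_cyl_hit_le {β : ℝ} (hβ : 1 < β) {G : Set (Sym2 V)} {z : V}
    {μ : Measure (ℕ → V)} (hμ : IsWalkLaw β G z μ) {h : V → ℝ≥0∞} {D : Set V}
    (hD : ∀ v ∈ D, 1 ≤ h v) {q : ℝ≥0∞} (hq : 1 ≤ q)
    (hsup : ∀ v, ∑' w, ENNReal.ofReal (transProb β G v w) * h w ≤ q * h v) (m : ℕ) :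
    ∀ (n : ℕ) (f : ℕ → V), f 0 = z →
      μ (cyl n f ∩ {ω | ∃ t, n ≤ t ∧ t ≤ n + m ∧ ω t ∈ D}) ≤ μ (cyl n f) * (q ^ m * h (f n)) := by
  induction m with
  | zero =>
    intro n f hf
    by_cases hfD : f n ∈ D
    · calc _ ≤ μ (cyl n f) * 1 := by rw [mul_one]; exact measure_mono Set.inter_subset_left
        _ ≤ _ := by gcongr; simpa using hD _ hfD
    · have : cyl n f ∩ {ω | ∃ t, n ≤ t ∧ t ≤ n + 0 ∧ ω t ∈ D} = ∅ := by
        ext ω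
        simp only [Set.mem_inter_iff, Set.mem_ofPred_eq, Set.mem_empty_iff_false, iff_false,
          not_and, not_exists]
        intro hω t h1 h2 h3
        obtain rfl : t = n := by omega
        exact hfD (hω t le_rfl ▸ h3)
      rw [this]; simp
  | succ m ih =>
    intro n f hf
    by_cases hfD : f n ∈ D
    · calc _ ≤ μ (cyl n f) * 1 := by rw [mul_one]; exact measure_mono Set.inter_subset_left
        _ ≤ _ := by
          gcongr
          exact one_le_mul_of_one_le_of_one_le (one_le_pow₀ hq) (hD _ hfD)
    · have hsub : cyl n f ∩ {ω | ∃ t, n ≤ t ∧ t ≤ n + (m + 1) ∧ ω t ∈ D} ⊆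
          ⋃ w : V, (cyl (n + 1) (Function.update f (n + 1) w) ∩
            {ω | ∃ t, n + 1 ≤ t ∧ t ≤ n + 1 + m ∧ ω t ∈ D}) := by
        rintro ω ⟨hω, t, h1, h2, h3⟩
        refine Set.mem_iUnion.2 ⟨ω (n + 1), ?_, t, ?_, by omega, h3⟩
        · intro i hi
          rcases Nat.lt_or_ge n i with hlt | hle
          · obtain rfl : i = n + 1 := by omega
            simp
          · rw [Function.update_of_ne (by omega)]
            exact hω i hle
        · rcases h1.lt_or_eq with hlt | rfl
          · exact hlt
          · exact absurd (hω n le_rfl ▸ h3) hfD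
      calc _ ≤ ∑' w : V, μ (cyl (n + 1) (Function.update f (n + 1) w) ∩
            {ω | ∃ t, n + 1 ≤ t ∧ t ≤ n + 1 + m ∧ ω t ∈ D}) :=
            (measure_mono hsub).trans (measure_iUnion_le _)
        _ ≤ ∑' w : V, μ (cyl n f) * q ^ m *
              (ENNReal.ofReal (transProb β G (f n) w) * h w) := by
            refine ENNReal.tsum_le_tsum fun w => ?_
            refine (ih (n + 1) _ (by simpa using hf)).trans (le_of_eq ?_)
            rw [measure_cyl_update hβ hμ n f hf, Function.update_self]
            ring
        _ = μ (cyl n f) * q ^ m * ∑' w : V, ENNReal.ofReal (transProb β G (f n) w) * h w :=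
            ENNReal.tsum_mul_left
        _ ≤ μ (cyl n f) * q ^ m * (q * h (f n)) := by gcongr; exact hsup _
        _ = _ := by ring

/-- A function `h` that grows at most by the factor `q` per step on average and is at least one
on `D` bounds the probability that the walk visits `D` before a given time. -/
lemma measure_hit_le {β : ℝ} (hβ : 1 < β) {G : Set (Sym2 V)} {z : V}
    {μ : Measure (ℕ → V)} (hμ : IsWalkLaw β G z μ) {h : V → ℝ≥0∞} {D : Set V}
    (hD : ∀ v ∈ D, 1 ≤ h v) {q : ℝ≥0∞} (hq : 1 ≤ q)
    (hsup : ∀ v, ∑' w, ENNReal.ofReal (transProb β G v w) * h w ≤ q * h v) (T : ℕ) :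
    μ {ω | ∃ t ≤ T, ω t ∈ D} ≤ q ^ T * h z := by
  have := hμ.1
  have h0 : μ (cyl 0 fun _ => z) = 1 := by
    have := hμ.2 0 (fun _ => z) rfl
    simpa [cyl] using this
  have hmeas : MeasurableSet (cyl 0 fun _ => z) := by
    have : cyl 0 (fun _ => z) = (fun ω : ℕ → V => ω 0) ⁻¹' {z} := by ext ω; simp [cyl]
    rw [this]
    exact measurable_pi_apply 0 (measurableSet_singleton z)
  have hc : μ (cyl 0 fun _ => z)ᶜ = 0 := (prob_compl_eq_zero_iff hmeas).2 h0
  have := measure_cyl_hit_le hβ hμ hD hq hsup T 0 (fun _ => z) rfl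
  rw [h0, one_mul] at this
  refine le_trans ?_ this
  have hd : μ ({ω : ℕ → V | ∃ t ≤ T, ω t ∈ D} \ cyl 0 fun _ => z) = 0 :=
    measure_mono_null (fun ω hω => hω.2) hc
  rw [← measure_inter_add_sdiff {ω : ℕ → V | ∃ t ≤ T, ω t ∈ D} hmeas, hd, add_zero]
  refine measure_mono ?_
  rintro ω ⟨⟨t, ht, hω⟩, h2⟩
  exact ⟨h2, t, by omega, by omega, hω⟩

/-- Weight of the step from `v` to `w`: `β` to the right, `1` in other directions. -/
def stepWt (β : ℝ) (v w : V) : ℝ := if w = (v.1 + 1, v.2) then β else 1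

/-- The four lattice neighbours of `v`. -/
def nbrs (v : V) : Finset V :=
  {(v.1 + 1, v.2), (v.1 - 1, v.2), (v.1, v.2 + 1), (v.1, v.2 - 1)}

open scoped Classical in
/-- The unnormalized generator of the walk. -/
def gen (β : ℝ) (G : Set (Sym2 V)) (F : V → ℝ) (v : V) : ℝ :=
  ∑ w ∈ nbrs v, if s(v, w) ∈ G then stepWt β v w * (F w - F v) else 0

lemma sum_nbrs (v : V) (g : V → ℝ) :
    ∑ w ∈ nbrs v, g w =
      g (v.1 + 1, v.2) + g (v.1 - 1, v.2) + g (v.1, v.2 + 1) + g (v.1, v.2 - 1) := by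
  unfold nbrs
  rw [Finset.sum_insert, Finset.sum_insert, Finset.sum_insert, Finset.sum_singleton]
  · ring
  all_goals
    simp only [Finset.mem_insert, Finset.mem_singleton, Prod.mk.injEq]
    omega

open scoped Classical in
lemma transProb_eq {β : ℝ} {G : Set (Sym2 V)} {v : V}
    (hG : ∀ w, s(v, w) ∈ G → w ∈ nbrs v) (hne : {u : V | s(v, u) ∈ G} ≠ ∅) (w : V) :
    transProb β G v w = (if s(v, w) ∈ G then stepWt β v w else 0) /
      ∑ u ∈ nbrs v, if s(v, u) ∈ G then stepWt β v u else 0 := by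
  have hset : {u : V | s(v, u) ∈ G} = ↑((nbrs v).filter fun u => s(v, u) ∈ G) := by
    ext u
    simp only [Set.mem_ofPred_eq, Finset.coe_filter]
    exact ⟨fun h => ⟨hG u h, h⟩, fun h => h.2⟩
  have hcard : ({u : V | s(v, u) ∈ G}.ncard : ℝ) =
      ∑ u ∈ nbrs v, if s(v, u) ∈ G then (1 : ℝ) else 0 := by
    rw [hset, Set.ncard_coe_finset, Finset.sum_boole]
  unfold transProb
  rw [if_neg hne, hcard, sum_nbrs, sum_nbrs]
  by_cases hw : s(v, w) ∈ G
  · by_cases hr : s(v, ((v.1 + 1, v.2) : V)) ∈ G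
    · simp only [hw, hr, stepWt, if_true, Prod.mk.injEq]
      have e1 : ¬ (v.1 - 1 = v.1 + 1) := by omega
      have e2 : ¬ (v.1 = v.1 + 1) := by omega
      simp only [e1, e2, false_and, if_false]
      split_ifs <;> congr 1 <;> ring
    · have hwr : w ≠ (v.1 + 1, v.2) := fun h => hr (h ▸ hw)
      simp only [hw, hr, stepWt, if_true, if_false, hwr, Prod.mk.injEq]
      have e1 : ¬ (v.1 - 1 = v.1 + 1) := by omega
      have e2 : ¬ (v.1 = v.1 + 1) := by omega
      simp only [e1, e2, false_and, if_false]
  · simp [hw]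

lemma tsum_transProb_le {β : ℝ} (hβ : 1 < β) {G : Set (Sym2 V)}
    (hG : ∀ v w, s(v, w) ∈ G → w ∈ nbrs v) {F : V → ℝ} (hF : ∀ v, 0 ≤ F v) {δ : ℝ} (hδ : 0 ≤ δ)
    (v : V) (hgen : gen β G F v ≤ δ * F v) :
    ∑' w, ENNReal.ofReal (transProb β G v w) * ENNReal.ofReal (F w) ≤
      ENNReal.ofReal (1 + δ) * ENNReal.ofReal (F v) := by
  classical
  by_cases hne : {u : V | s(v, u) ∈ G} = ∅
  · rw [tsum_eq_single v]
    · gcongr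
      unfold transProb
      rw [if_pos hne, if_pos rfl]
      linarith
    · intro w hw
      unfold transProb
      rw [if_pos hne, if_neg hw]
      simp
  · have hteq := fun w => transProb_eq (β := β) (hG v) hne w
    set W := ∑ u ∈ nbrs v, if s(v, u) ∈ G then stepWt β v u else 0 with hW
    have hwt : ∀ u, 1 ≤ stepWt β v u := by
      intro u; unfold stepWt; split_ifs <;> linarith
    have hW1 : 1 ≤ W := by
      obtain ⟨u, hu⟩ := Set.nonempty_iff_ne_empty.2 hne
      have := Finset.single_le_sum (f := fun u => if s(v, u) ∈ G then stepWt β v u else 0)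
        (fun u _ => by split_ifs; exacts [by linarith [hwt u], le_rfl]) (hG v u hu)
      simp only [Set.mem_ofPred_eq] at hu
      simp only [hu, if_true] at this
      linarith [hwt u]
    rw [tsum_eq_sum (s := nbrs v)]
    · rw [← ENNReal.ofReal_mul (by linarith)]
      have : ∀ w ∈ nbrs v, ENNReal.ofReal (transProb β G v w) * ENNReal.ofReal (F w) =
          ENNReal.ofReal (transProb β G v w * F w) := fun w _ =>
        (ENNReal.ofReal_mul (transProb_nonneg hβ G v w)).symm
      rw [Finset.sum_congr rfl this, ← ENNReal.ofReal_sum_of_nonneg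
        (fun w _ => mul_nonneg (transProb_nonneg hβ G v w) (hF w))]
      refine ENNReal.ofReal_le_ofReal ?_
      have e : ∑ w ∈ nbrs v, transProb β G v w * F w = (gen β G F v + W * F v) / W := by
        rw [gen, hW, Finset.sum_mul, ← Finset.sum_add_distrib, Finset.sum_div]
        refine Finset.sum_congr rfl fun w _ => ?_
        rw [hteq w, ← hW]
        split_ifs <;> ring
      rw [e, div_le_iff₀ (by linarith)]
      nlinarith [mul_nonneg (mul_nonneg hδ (hF v)) (sub_nonneg.2 hW1)]
    · intro w hw
      have : s(v, w) ∉ G := fun h => hw (hG v w h)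
      rw [hteq w, if_neg this]
      simp

lemma bF_pos (k : ℕ) : 0 < bF k := by unfold bF; positivity

lemma bF_succ (k : ℕ) : bF (k + 1) = 3 ^ k * bF k := by
  unfold bF
  rw [Nat.triangle_succ, pow_add]
  ring

lemma cF_pos (k : ℕ) : 0 < cF k := by unfold cF; positivity

lemma bF_eq_cF (k : ℕ) : bF k = 4 * cF (k + 1) := by
  unfold bF cF
  rw [Nat.add_sub_cancel, show k + 1 - 2 = k - 1 by omega]

lemma bF_mono : Monotone bF :=
  monotone_nat_of_le_succ fun k => by
    rw [bF_succ]
    exact Nat.le_mul_of_pos_left _ (by positivity)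

lemma cF_mono : Monotone cF := by
  refine monotone_nat_of_le_succ fun k => ?_
  rcases k with _ | k
  · decide
  · have h1 := bF_eq_cF k
    have h2 := bF_eq_cF (k + 1)
    have := bF_mono (Nat.le_succ k)
    simp only [Nat.succ_eq_add_one] at this
    omega

lemma three_mul_bF_le {k : ℕ} (hk : 1 ≤ k) : 3 * bF k ≤ bF (k + 1) := by
  rw [bF_succ]
  gcongr
  exact Nat.le_self_pow (by omega) 3

lemma bF_dvd {k m : ℕ} (h : k ≤ m) : bF k ∣ bF m := by
  induction m, h using Nat.le_induction with
  | base => exact dvd_rfl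
  | succ m _ ih => rw [bF_succ]; exact ih.mul_left _

lemma qF_mul_bF (k : ℕ) : ((qF k : ℕ) : ℤ) * (bF k : ℤ) + bF k = bF (k + 1) := by
  have h : qF k + 1 = 3 ^ k := Nat.sub_add_cancel (Nat.one_le_pow _ _ (by norm_num))
  rw [bF_succ, ← h]
  push_cast
  ring

lemma IsTip.nonneg {k : ℕ} {x : ℤ} (h : IsTip k x) : 0 ≤ x := by
  induction h with
  | zero k => exact le_rfl
  | step k x j _ h1 _ ih =>
    have : (0 : ℤ) ≤ ((j : ℤ) - 1) * (bF k : ℤ) := mul_nonneg (by omega) (by omega)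
    omega

lemma IsTip.dvd {k : ℕ} {x : ℤ} (h : IsTip k x) : (bF k : ℤ) ∣ x := by
  induction h with
  | zero k => exact dvd_zero _
  | step k x j _ h1 _ ih =>
    refine dvd_add (dvd_trans ?_ ih) (dvd_mul_left _ _)
    exact_mod_cast bF_dvd (Nat.le_succ k)

/-- Branches of order at most `n` keep clear of the last `b_n` columns before `b_{n+1}`. -/
lemma IsTip.add_le {k : ℕ} {x : ℤ} (h : IsTip k x) (hk : 1 ≤ k) :
    ∀ n, k ≤ n → x < bF (n + 1) → x + bF k + bF n ≤ bF (n + 1) := by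
  induction h with
  | zero k =>
    intro n hn _
    have := bF_mono hn
    have := three_mul_bF_le (hk.trans hn)
    omega
  | step k x j hx h1 h2 ih =>
    intro n hn hlt
    have hmul : ((j : ℤ) - 1) * (bF k : ℤ) + bF k = j * bF k := by ring
    have hj : (j : ℤ) * bF k ≤ qF k * bF k :=
      mul_le_mul_of_nonneg_right (by exact_mod_cast h2) (by positivity)
    have hq := qF_mul_bF k
    have h0 : (0 : ℤ) ≤ ((j : ℤ) - 1) * (bF k : ℤ) := mul_nonneg (by omega) (by omega)
    have hx0 := hx.nonneg
    rcases hn.lt_or_eq with hlt' | rfl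
    · have := ih (by omega) n hlt' (by omega)
      omega
    · have : x = 0 := by
        refine Int.eq_zero_of_abs_lt_dvd hx.dvd ?_
        rw [abs_of_nonneg hx0]
        omega
      omega

lemma IsTip.eq_zero_of_mem_zone {k n : ℕ} {t x : ℤ} (h : IsTip k t) (hk : 1 ≤ k)
    (h1 : t ≤ x) (h2 : x < t + bF k) (h3 : (bF (n + 1) : ℤ) ≤ x + bF n) (h4 : x < bF (n + 1)) :
    n + 1 ≤ k ∧ t = 0 := by
  have hk' : n + 1 ≤ k := by
    by_contra hlt
    have := h.add_le hk n (by omega) (by omega)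
    omega
  refine ⟨hk', Int.eq_zero_of_abs_lt_dvd h.dvd ?_⟩
  rw [abs_of_nonneg h.nonneg]
  have := bF_mono hk'
  omega

lemma eF_le (γ : ℝ) (k : ℕ) : eF γ k ≤ cF k := min_le_right _ _

lemma one_le_eF {γ : ℝ} (hγ : 1 < γ) {k : ℕ} (hk : 2 ≤ k) : 1 ≤ eF γ k := by
  refine le_min (Nat.one_le_ceil_iff.2 (div_pos (Real.log_pos ?_) (Real.log_pos hγ))) (cF_pos k)
  exact_mod_cast hk

/-- Necessary condition for the edge from `(x, y)` to `(x + 1, y)` to be in `η`. -/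
def HKind (γ : ℝ) (x y : ℤ) : Prop :=
  (∃ (k : ℕ) (l t : ℤ), 1 ≤ k ∧ Odd l ∧ IsTip k t ∧ y = rowY k l ∧ t ≤ x ∧ x + 2 ≤ t + bF k) ∨
  (∃ (k : ℕ) (l t : ℤ), 2 ≤ k ∧ Odd l ∧ IsTip k t ∧
    ((y = rowY k l + 1 ∧ anchorX k t - eF γ k ≤ x ∧ x < anchorX k t) ∨
     (y = rowY k l + 2 ∧ anchorX k t - eF γ k ≤ x ∧ x < anchorX k t - eF γ k + cF k)))

/-- Necessary condition for the edge from `(x, y)` to `(x, y + 1)` to be in `η`. -/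
def VKind (γ : ℝ) (x y : ℤ) : Prop :=
  (∃ (k : ℕ) (t p : ℤ), 1 ≤ k ∧ IsTip k t ∧ x = t + bF k - 1 ∧ ¬ 4 ∣ p ∧ ¬ 4 ∣ p + 1 ∧
    3 * 2 ^ (k - 1) * p ≤ y ∧ y < 3 * 2 ^ (k - 1) * (p + 1)) ∨
  (∃ (k : ℕ) (l t : ℤ), 2 ≤ k ∧ Odd l ∧ IsTip k t ∧
    ((x = anchorX k t ∧ y = rowY k l) ∨ (x = anchorX k t - eF γ k ∧ y = rowY k l + 1)))

lemma etaEdges_kind {γ : ℝ} {f : Sym2 V} (hf : f ∈ etaEdges γ) :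
    (∃ x y : ℤ, f = s((x, y), (x + 1, y)) ∧ HKind γ x y) ∨
    (∃ x y : ℤ, f = s((x, y), (x, y + 1)) ∧ VKind γ x y) := by
  rcases hf with ⟨k, l, t, hk, hl, ht, ⟨i, hi, rfl⟩ | ⟨j, hj, rfl⟩⟩ | ⟨k, l, t, hk, hl, ht, hf⟩
  · exact .inl ⟨_, _, rfl, .inl ⟨k, l, t, hk, hl, ht, rfl, by omega, by omega⟩⟩
  · have hj' : (j : ℤ) < 3 * 2 ^ (k - 1) := by exact_mod_cast hj
    obtain ⟨a, rfl⟩ := hl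
    unfold dirF
    split_ifs with ho
    · obtain ⟨m, hm⟩ := ho
      refine .inr ⟨t + bF k - 1, rowY k (2 * a + 1) + j, by ring_nf, .inl ⟨k, t, 2 * a + 1, hk,
        ht, rfl, by omega, by omega, ?_, ?_⟩⟩ <;> unfold rowY <;> nlinarith
    · rw [Int.not_odd_iff_even] at ho
      obtain ⟨m, hm⟩ := ho
      refine .inr ⟨t + bF k - 1, rowY k (2 * a + 1) - (j + 1), ?_, .inl ⟨k, t, 2 * a, hk,
        ht, rfl, by omega, by omega, ?_, ?_⟩⟩
      · rw [Sym2.eq_swap]; ring_nf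
      all_goals unfold rowY; nlinarith
  · rcases hf with ((rfl | rfl) | ⟨i, hi, rfl⟩) | ⟨i, hi, rfl⟩
    · exact .inr ⟨_, _, rfl, .inr ⟨k, l, t, hk, hl, ht, .inl ⟨rfl, rfl⟩⟩⟩
    · exact .inr ⟨_, _, by ring_nf, .inr ⟨k, l, t, hk, hl, ht, .inr ⟨rfl, rfl⟩⟩⟩
    · exact .inl ⟨_, _, rfl, .inr ⟨k, l, t, hk, hl, ht, .inl ⟨rfl, by omega, by omega⟩⟩⟩
    · exact .inl ⟨_, _, rfl, .inr ⟨k, l, t, hk, hl, ht, .inr ⟨rfl, by omega, by omega⟩⟩⟩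

lemma HKind.of_mem {γ : ℝ} {x y : ℤ} (h : s(((x, y) : V), (x + 1, y)) ∈ etaEdges γ) :
    HKind γ x y := by
  rcases etaEdges_kind h with ⟨x', y', he, hk⟩ | ⟨x', y', he, _⟩
  · rw [Sym2.eq_iff] at he
    simp only [Prod.mk.injEq] at he
    obtain ⟨rfl, rfl⟩ : x = x' ∧ y = y' := by omega
    exact hk
  · rw [Sym2.eq_iff] at he
    simp only [Prod.mk.injEq] at he
    omega

lemma VKind.of_mem {γ : ℝ} {x y : ℤ} (h : s(((x, y) : V), (x, y + 1)) ∈ etaEdges γ) :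
    VKind γ x y := by
  rcases etaEdges_kind h with ⟨x', y', he, _⟩ | ⟨x', y', he, hk⟩
  · rw [Sym2.eq_iff] at he
    simp only [Prod.mk.injEq] at he
    omega
  · rw [Sym2.eq_iff] at he
    simp only [Prod.mk.injEq] at he
    obtain ⟨rfl, rfl⟩ : x = x' ∧ y = y' := by omega
    exact hk

lemma mem_nbrs_of_mem_etaEdges {γ : ℝ} (v w : V) (h : s(v, w) ∈ etaEdges γ) : w ∈ nbrs v := by
  obtain ⟨a, b⟩ := v
  obtain ⟨a', b'⟩ := w
  simp only [nbrs, Finset.mem_insert, Finset.mem_singleton, Prod.mk.injEq]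
  rcases etaEdges_kind h with ⟨x', y', he, _⟩ | ⟨x', y', he, _⟩ <;>
  · rw [Sym2.eq_iff] at he
    simp only [Prod.mk.injEq] at he
    omega

lemma le_anchorX {k : ℕ} (hk : 2 ≤ k) (t : ℤ) :
    t + bF (k - 1) + cF k ≤ anchorX k t ∧ anchorX k t + 2 * cF k + 1 = t + bF k := by
  obtain ⟨n, rfl⟩ : ∃ n, k = n + 1 := ⟨k - 1, by omega⟩
  have h1 := three_mul_bF_le (k := n) (by omega)
  have h2 := bF_eq_cF n
  have h3 := cF_pos (n + 1)
  rw [Nat.add_sub_cancel]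
  unfold anchorX
  omega

/-- Only traps of branches of order `n + 1` with tip on the `y`-axis meet the last `b_n` columns
before `b_{n+1}`. -/
lemma trap_mem_zone {k n : ℕ} {t x : ℤ} (ht : IsTip k t) (hk : 2 ≤ k)
    (h1 : anchorX k t - cF k ≤ x) (h2 : x ≤ anchorX k t + cF k)
    (h3 : (bF (n + 1) : ℤ) ≤ x + bF n) (h4 : x < bF (n + 1)) : k = n + 1 ∧ t = 0 := by
  have h := le_anchorX hk t
  have hc := cF_pos k
  obtain ⟨hk', rfl⟩ := ht.eq_zero_of_mem_zone (x := x) (by omega) (by omega) (by omega) h3 h4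
  refine ⟨?_, rfl⟩
  by_contra hne
  have := bF_mono (show n + 1 ≤ k - 1 by omega)
  omega

lemma rowY_zmod (k : ℕ) (l : ℤ) : (3 : ℤ) ∣ rowY k l := by
  unfold rowY
  exact ⟨2 ^ (k - 1) * l, by ring⟩

lemma not_dvd_rowY {k n : ℕ} (hk : 1 ≤ k) (hkn : k ≤ n) {l : ℤ} (hl : Odd l) :
    ¬ (3 * 2 ^ n : ℤ) ∣ rowY k l := by
  rintro ⟨m, hm⟩
  obtain ⟨a, rfl⟩ := hl
  obtain ⟨j, rfl⟩ := Nat.exists_eq_add_of_le hkn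
  obtain ⟨k, rfl⟩ := Nat.exists_eq_add_of_le' hk
  unfold rowY at hm
  rw [Nat.add_sub_cancel] at hm
  have h2 : (3 * 2 ^ k : ℤ) ≠ 0 := by positivity
  have : (2 * a + 1 : ℤ) = 2 * (2 ^ j * m) := by
    apply mul_left_cancel₀ h2
    rw [hm]; ring
  omega

lemma dvd_rowY {k n : ℕ} (hkn : n < k) (l : ℤ) : (3 * 2 ^ n : ℤ) ∣ rowY k l := by
  obtain ⟨j, rfl⟩ := Nat.exists_eq_add_of_le hkn
  refine ⟨2 ^ j * l, ?_⟩
  unfold rowY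
  rw [show n.succ + j - 1 = n + j by omega, pow_add]
  ring

lemma HKind.zone {γ : ℝ} {n : ℕ} {x y : ℤ} (h : HKind γ x y)
    (h3 : (bF (n + 1) : ℤ) ≤ x + bF n) (h4 : x < bF (n + 1)) :
    ((∃ l, Odd l ∧ y = rowY (n + 1) l) ∨ (3 * 2 ^ (n + 1) : ℤ) ∣ y) ∨
    ((∃ l, Odd l ∧ y - 1 = rowY (n + 1) l) ∧
      anchorX (n + 1) 0 - eF γ (n + 1) ≤ x ∧ x < anchorX (n + 1) 0) ∨
    ((∃ l, Odd l ∧ y - 2 = rowY (n + 1) l) ∧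
      anchorX (n + 1) 0 - eF γ (n + 1) ≤ x ∧
      x < anchorX (n + 1) 0 - eF γ (n + 1) + cF (n + 1)) := by
  rcases h with ⟨k, l, t, hk, hl, ht, rfl, h5, h6⟩ | ⟨k, l, t, hk, hl, ht, h⟩
  · left
    obtain ⟨hk', rfl⟩ := ht.eq_zero_of_mem_zone hk h5 (by omega) h3 h4
    rcases hk'.lt_or_eq with hlt | rfl
    · exact .inr (dvd_rowY hlt l)
    · exact .inl ⟨l, hl, rfl⟩
  · right
    have he := eF_le γ k
    obtain ⟨rfl, rfl⟩ := trap_mem_zone (x := x) ht hk (by omega) (by omega) h3 h4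
    rcases h with ⟨rfl, h⟩ | ⟨rfl, h⟩
    · exact .inl ⟨⟨l, hl, by ring⟩, h⟩
    · exact .inr ⟨⟨l, hl, by ring⟩, h⟩

lemma VKind.left {γ : ℝ} {n : ℕ} {x y : ℤ} (h : VKind γ x y) (h4 : x + 2 ≤ bF (n + 1)) :
    (x + bF n < bF (n + 1) ∧ ¬ (3 * 2 ^ (n + 1) : ℤ) ∣ y ∧ ¬ (3 * 2 ^ (n + 1) : ℤ) ∣ y + 1) ∨
    (x = anchorX (n + 1) 0 ∧ ∃ l, Odd l ∧ y = rowY (n + 1) l) ∨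
    (x = anchorX (n + 1) 0 - eF γ (n + 1) ∧ ∃ l, Odd l ∧ y - 1 = rowY (n + 1) l) := by
  rcases h with ⟨k, t, p, hk, ht, rfl, hp1, hp2, h5, h6⟩ | ⟨k, l, t, hk, hl, ht, h⟩
  · left
    have hkn : k ≤ n := by
      by_contra hlt
      have := bF_mono (show n + 1 ≤ k by omega)
      have := ht.nonneg
      omega
    have hb := bF_pos k
    have hle := ht.add_le hk n hkn (by omega)
    obtain ⟨j, rfl⟩ := Nat.exists_eq_add_of_le hkn
    obtain ⟨k, rfl⟩ := Nat.exists_eq_add_of_le' hk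
    rw [Nat.add_sub_cancel] at h5 h6
    have e : (3 * 2 ^ (k + 1 + j + 1) : ℤ) = 3 * 2 ^ k * (4 * 2 ^ j) := by ring
    have h2 : (0 : ℤ) < 3 * 2 ^ k := by positivity
    refine ⟨by omega, ?_, ?_⟩
    · rintro ⟨m, hm⟩
      rw [hm, e, mul_assoc (3 * 2 ^ k : ℤ) (4 * 2 ^ j)] at h5 h6
      have h7 := le_of_mul_le_mul_left h5 h2
      have h8 := lt_of_mul_lt_mul_left h6 h2.le
      exact hp1 ⟨2 ^ j * m, by linarith⟩
    · rintro ⟨m, hm⟩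
      have h5 : 3 * 2 ^ k * p < y + 1 := by omega
      have h6 : y + 1 ≤ 3 * 2 ^ k * (p + 1) := by omega
      rw [hm, e, mul_assoc (3 * 2 ^ k : ℤ) (4 * 2 ^ j)] at h5 h6
      have h7 := lt_of_mul_lt_mul_left h5 h2.le
      have h8 := le_of_mul_le_mul_left h6 h2
      exact hp2 ⟨2 ^ j * m, by linarith⟩
  · have he := eF_le γ k
    have ha := le_anchorX hk t
    have hc := cF_pos k
    have hx1 : anchorX k t - cF k ≤ x := by omega
    have hx2 : x ≤ anchorX k t + cF k := by omega
    by_cases h3 : (bF (n + 1) : ℤ) ≤ x + bF n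
    · right
      obtain ⟨rfl, rfl⟩ := trap_mem_zone (x := x) ht hk hx1 hx2 h3 (by omega)
      rcases h with ⟨rfl, rfl⟩ | ⟨rfl, rfl⟩
      · exact .inl ⟨rfl, l, hl, rfl⟩
      · exact .inr ⟨rfl, l, hl, by ring⟩
    · left
      have hkn : k ≤ n := by
        by_contra hlt
        have h7 := ht.nonneg
        rcases eq_or_lt_of_le (show n + 1 ≤ k by omega) with rfl | hlt'
        · have := bF_eq_cF n
          omega
        · have := bF_mono (show n + 1 ≤ k - 1 by omega)
          omega
      have h3d : (3 : ℤ) ∣ 3 * 2 ^ (n + 1) := dvd_mul_right _ _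
      have hr := rowY_zmod k l
      have hnd := not_dvd_rowY (n := n + 1) (by omega) (by omega : k ≤ n + 1) hl
      refine ⟨by omega, fun hd => ?_, fun hd => ?_⟩
      · rcases h with ⟨_, rfl⟩ | ⟨_, rfl⟩
        · exact hnd hd
        · have := h3d.trans hd
          omega
      · have := h3d.trans hd
        omega

open scoped Classical in
lemma gen_eq (β : ℝ) (G : Set (Sym2 V)) (F : V → ℝ) (x y : ℤ) :
    gen β G F (x, y) =
      (if s(((x, y) : V), (x + 1, y)) ∈ G then β * (F (x + 1, y) - F (x, y)) else 0) +
      (if s(((x - 1, y) : V), (x - 1 + 1, y)) ∈ G then F (x - 1, y) - F (x, y) else 0) +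
      (if s(((x, y) : V), (x, y + 1)) ∈ G then F (x, y + 1) - F (x, y) else 0) +
      (if s(((x, y - 1) : V), (x, y - 1 + 1)) ∈ G then F (x, y - 1) - F (x, y) else 0) := by
  have e1 : ¬ (x - 1 = x + 1) := by omega
  have e2 : ¬ (x = x + 1) := by omega
  rw [gen, sum_nbrs]
  simp only [stepWt, Prod.mk.injEq, e1, e2, false_and, if_true, if_false, one_mul]
  rw [Sym2.eq_swap (a := ((x, y) : V)) (b := (x - 1, y)),
    Sym2.eq_swap (a := ((x, y) : V)) (b := (x, y - 1)), sub_add_cancel, sub_add_cancel]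

/-- Drop of the barrier function along the entrance of a trap. -/
def entDrop (β : ℝ) (i : ℕ) : ℝ := β + ∑ t ∈ Finset.range i, β ^ (t + 1)

/-- Drop of the barrier function along the core of a trap with entrance length `e`. -/
def coreDrop (β : ℝ) (e i : ℕ) : ℝ :=
  entDrop β e + β ^ (e + 1) + ∑ t ∈ Finset.range i, β ^ e * β⁻¹ ^ t

lemma entDrop_succ (β : ℝ) (i : ℕ) : entDrop β (i + 1) = entDrop β i + β ^ (i + 1) := by
  unfold entDrop; rw [Finset.sum_range_succ]; ring

lemma coreDrop_succ (β : ℝ) (e i : ℕ) :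
    coreDrop β e (i + 1) = coreDrop β e i + β ^ e * β⁻¹ ^ i := by
  unfold coreDrop; rw [Finset.sum_range_succ]; ring

open scoped Classical in
/-- The barrier function of a row of traps: it increases from `0` to `1` when passing the anchor
to the right, and decreases along the trap in such a way that it is harmonic there except at the
end of the core. The predicate `R` singles out the rows that carry a trap with anchor in column
`d`, entrance length `e` and core length `c`; the predicate `M` the rows not separated by the
traps. -/
def barrier (β : ℝ) (R M : ℤ → Prop) (d : ℤ) (e c : ℕ) (v : V) : ℝ :=
  if R (v.2 - 1) ∧ d - e ≤ v.1 ∧ v.1 ≤ d then -entDrop β (d - v.1).toNat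
  else if R (v.2 - 2) ∧ d - e ≤ v.1 ∧ v.1 ≤ d - e + c then -coreDrop β e (v.1 - (d - e)).toNat
  else if M v.2 ∨ d < v.1 then 1 else 0

section barrier

variable {β : ℝ} {R M : ℤ → Prop} {d : ℤ} {e c : ℕ}

lemma barrier_entrance {x y : ℤ} {i : ℕ} (hR : R (y - 1)) (hi : i ≤ e) (hx : x = d - i) :
    barrier β R M d e c (x, y) = -entDrop β i := by
  unfold barrier
  rw [if_pos ⟨hR, by dsimp only; omega, by dsimp only; omega⟩]
  congr 2
  dsimp only
  omega

lemma barrier_core {x y : ℤ} {i : ℕ} (hR3 : ∀ y, R y → (3 : ℤ) ∣ y) (hR : R (y - 2))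
    (hi : i ≤ c) (hx : x = d - e + i) : barrier β R M d e c (x, y) = -coreDrop β e i := by
  unfold barrier
  rw [if_neg, if_pos ⟨hR, by dsimp only; omega, by dsimp only; omega⟩]
  · congr 2
    dsimp only
    omega
  · rintro ⟨h, _⟩
    have := hR3 _ h
    have := hR3 _ hR
    omega

open scoped Classical in
lemma barrier_outside {x y : ℤ} (h1 : ¬ (R (y - 1) ∧ d - e ≤ x ∧ x ≤ d))
    (h2 : ¬ (R (y - 2) ∧ d - e ≤ x ∧ x ≤ d - e + c)) :
    barrier β R M d e c (x, y) = if M y ∨ d < x then 1 else 0 := by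
  unfold barrier
  rw [if_neg h1, if_neg h2]

lemma ite_le_ite_of_imp {p q : Prop} [Decidable p] [Decidable q] (h : p → q) :
    (if p then (1 : ℝ) else 0) ≤ if q then 1 else 0 := by
  split_ifs with hp hq
  · exact le_rfl
  · exact absurd (h hp) hq
  · exact zero_le_one
  · exact le_rfl

lemma ite_le_zero {p : Prop} [Decidable p] {a : ℝ} (h : p → a ≤ 0) :
    (if p then a else 0) ≤ 0 := by
  split_ifs with hp
  · exact h hp
  · exact le_rfl

open scoped Classical in
/-- The barrier function is superharmonic up to a small error at the end of the core. -/
lemma gen_barrier_le (hβ : 1 < β) {G : Set (Sym2 V)} (he : 1 ≤ e) (hec : e ≤ c) (hc : 2 ≤ c)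
    (hR3 : ∀ y, R y → (3 : ℤ) ∣ y) (hM3 : ∀ y, M y → (3 : ℤ) ∣ y) (hRM : ∀ y, R y → ¬ M y)
    (hH : ∀ x y : ℤ, s(((x, y) : V), (x + 1, y)) ∈ G → d + 1 ≤ x + 2 * c → x ≤ d + 2 * c →
      (R y ∨ M y) ∨ (R (y - 1) ∧ d - e ≤ x ∧ x < d) ∨
        (R (y - 2) ∧ d - e ≤ x ∧ x < d - e + c))
    (hV : ∀ x y : ℤ, s(((x, y) : V), (x, y + 1)) ∈ G → x + 1 ≤ d + 2 * c →
      (x + 2 * c < d + 1 ∧ ¬ M y ∧ ¬ M (y + 1)) ∨ (x = d ∧ R y) ∨ (x = d - e ∧ R (y - 1)))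
    (hE1 : ∀ x y : ℤ, R (y - 1) → d - e ≤ x → x < d → s(((x, y) : V), (x + 1, y)) ∈ G)
    (hE2 : ∀ x y : ℤ, R (y - 2) → d - e ≤ x → x < d - e + c → s(((x, y) : V), (x + 1, y)) ∈ G)
    (hE3 : ∀ y : ℤ, R y → s(((d, y) : V), (d, y + 1)) ∈ G)
    (hE4 : ∀ y : ℤ, R (y - 1) → s(((d - e, y) : V), (d - e, y + 1)) ∈ G) (v : V) :
    gen β G (barrier β R M d e c) v ≤ β ^ (e + 1) * β⁻¹ ^ c := by
  have hinv : β * β⁻¹ = 1 := mul_inv_cancel₀ (by positivity)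
  have hpos : 0 ≤ β ^ (e + 1) * β⁻¹ ^ c := by positivity
  obtain ⟨x, y⟩ := v
  rw [gen_eq]
  by_cases hent : R (y - 1) ∧ d - e ≤ x ∧ x ≤ d
  · refine le_trans (le_of_eq ?_) hpos
    obtain ⟨hR, hx1, hx2⟩ := hent
    have hmod := hR3 _ hR
    obtain ⟨i, hi⟩ : ∃ i : ℕ, x = d - i := ⟨(d - x).toNat, by omega⟩
    have hn2 : ¬ R (y - 2) := fun h => by have := hR3 _ h; omega
    have hn0 : ¬ (R y ∨ M y) := by
      rintro (h | h)
      · have := hR3 _ h; omega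
      · have := hM3 _ h; omega
    have k1 : s(((x, y) : V), (x + 1, y)) ∈ G ↔ i ≠ 0 := by
      refine ⟨fun h => ?_, fun h => hE1 x y hR hx1 (by omega)⟩
      rcases hH x y h (by omega) (by omega) with h | h | h
      · exact absurd h hn0
      · omega
      · exact absurd h.1 hn2
    have k2 : s(((x - 1, y) : V), (x - 1 + 1, y)) ∈ G ↔ i ≠ e := by
      refine ⟨fun h => ?_, fun h => hE1 (x - 1) y hR (by omega) (by omega)⟩
      rcases hH (x - 1) y h (by omega) (by omega) with h | h | h
      · exact absurd h hn0
      · omega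
      · exact absurd h.1 hn2
    have k3 : s(((x, y) : V), (x, y + 1)) ∈ G ↔ i = e := by
      refine ⟨fun h => ?_, fun h => ?_⟩
      · rcases hV x y h (by omega) with h | h | h
        · omega
        · exact absurd (.inl h.2) hn0
        · omega
      · obtain rfl : x = d - e := by omega
        exact hE4 y hR
    have k4 : s(((x, y - 1) : V), (x, y - 1 + 1)) ∈ G ↔ i = 0 := by
      refine ⟨fun h => ?_, fun h => ?_⟩
      · rcases hV x (y - 1) h (by omega) with h | h | h
        · omega
        · omega
        · rw [sub_sub] at h
          exact absurd h.2 hn2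
      · obtain rfl : x = d := by omega
        exact hE3 _ hR
    simp only [k1, k2, k3, k4]
    have f0 := barrier_entrance (β := β) (M := M) (c := c) (e := e) hR (by omega : i ≤ e) hi
    rcases Nat.eq_zero_or_pos i with rfl | hi0
    · have f2 := barrier_entrance (β := β) (M := M) (c := c) (i := 1) (x := x - 1) (d := d) (e := e) hR he
        (by omega)
      have f4 : barrier β R M d e c (x, y - 1) = 0 := by
        rw [barrier_outside, if_neg]
        · rintro (h | h)
          · exact hRM _ hR h
          · omega
        · rintro ⟨h, -⟩; have := hR3 _ h; omega
        · rintro ⟨h, -⟩; have := hR3 _ h; omega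
      rw [if_neg (by simp), if_pos (by omega), if_neg (by omega), if_pos rfl, f0, f2, f4,
        entDrop_succ]
      simp only [entDrop, Finset.range_zero, Finset.sum_empty]
      ring
    · obtain ⟨j, rfl⟩ := Nat.exists_eq_add_of_le' hi0
      have f1 := barrier_entrance (β := β) (M := M) (c := c) (i := j) (x := x + 1) (d := d) (e := e) hR
        (by omega : j ≤ e) (by omega)
      rw [if_pos (by omega), if_neg (by omega : ¬ j + 1 = 0), f0, f1, entDrop_succ]
      by_cases hje : j + 1 = e
      · have f3 := barrier_core (β := β) (M := M) (i := 0) (x := x) (y := y + 1) (d := d) (e := e)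
          (c := c) hR3 (by convert hR using 1; ring) (by omega) (by omega)
        rw [if_neg (by omega), if_pos hje, f3]
        subst hje
        simp only [coreDrop, entDrop_succ, Finset.range_zero, Finset.sum_empty]
        ring
      · have f2 := barrier_entrance (β := β) (M := M) (c := c) (i := j + 1 + 1) (x := x - 1)
          (d := d) (e := e) hR (by omega) (by push_cast; push_cast at hi; omega)
        rw [if_pos hje, if_neg hje, f2, entDrop_succ, entDrop_succ]
        ring
  by_cases hcore : R (y - 2) ∧ d - e ≤ x ∧ x ≤ d - e + c
  · obtain ⟨hR, hx1, hx2⟩ := hcore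
    have hmod := hR3 _ hR
    obtain ⟨i, hi⟩ : ∃ i : ℕ, x = d - e + i := ⟨(x - (d - e)).toNat, by omega⟩
    have hn2 : ¬ R (y - 1) := fun h => by have := hR3 _ h; omega
    have hn0 : ¬ (R y ∨ M y) := by
      rintro (h | h)
      · have := hR3 _ h; omega
      · have := hM3 _ h; omega
    have k1 : s(((x, y) : V), (x + 1, y)) ∈ G ↔ i ≠ c := by
      refine ⟨fun h => ?_, fun h => hE2 x y hR hx1 (by omega)⟩
      rcases hH x y h (by omega) (by omega) with h | h | h
      · exact absurd h hn0
      · exact absurd h.1 hn2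
      · omega
    have k2 : s(((x - 1, y) : V), (x - 1 + 1, y)) ∈ G ↔ i ≠ 0 := by
      refine ⟨fun h => ?_, fun h => hE2 (x - 1) y hR (by omega) (by omega)⟩
      rcases hH (x - 1) y h (by omega) (by omega) with h | h | h
      · exact absurd h hn0
      · exact absurd h.1 hn2
      · omega
    have k3 : ¬ s(((x, y) : V), (x, y + 1)) ∈ G := by
      intro h
      rcases hV x y h (by omega) with h | h | h
      · omega
      · exact hn0 (.inl h.2)
      · exact hn2 h.2
    have k4 : s(((x, y - 1) : V), (x, y - 1 + 1)) ∈ G ↔ i = 0 := by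
      refine ⟨fun h => ?_, fun h => ?_⟩
      · rcases hV x (y - 1) h (by omega) with h | h | h
        · omega
        · exact absurd h.2 hn2
        · omega
      · obtain rfl : x = d - e := by omega
        exact hE4 _ (by convert hR using 1; ring)
    simp only [k1, k2, k4, if_neg k3]
    have f0 := barrier_core (β := β) (M := M) hR3 hR (by omega : i ≤ c) hi
    rcases Nat.eq_zero_or_pos i with rfl | hi0
    · have f1 := barrier_core (β := β) (M := M) (i := 1) (x := x + 1) (d := d) (e := e) (c := c)
        hR3 hR (by omega) (by omega)
      have f4 := barrier_entrance (β := β) (M := M) (c := c) (i := e) (e := e) (x := x)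
        (y := y - 1) (d := d) (R := R) (by convert hR using 1; ring) le_rfl (by omega)
      rw [if_pos (by omega), if_neg (by simp), if_pos rfl, f0, f1, f4, coreDrop_succ]
      refine le_trans (le_of_eq ?_) hpos
      simp only [coreDrop, Finset.range_zero, Finset.sum_empty]
      ring
    · obtain ⟨j, rfl⟩ := Nat.exists_eq_add_of_le' hi0
      have f2 := barrier_core (β := β) (M := M) (i := j) (x := x - 1) (d := d) (e := e) (c := c)
        hR3 hR (by omega) (by omega)
      rw [if_pos (by omega : j + 1 ≠ 0), if_neg (by omega : ¬ j + 1 = 0), f0, f2, coreDrop_succ]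
      by_cases hjc : j + 1 = c
      · rw [if_neg (by omega)]
        subst hjc
        linear_combination (-(β ^ e * β⁻¹ ^ j)) * hinv
      · have f1 := barrier_core (β := β) (M := M) (i := j + 1 + 1) (x := x + 1) (d := d) (e := e)
          (c := c) hR3 hR (by omega) (by push_cast; push_cast at hi; omega)
        rw [if_pos hjc, f1, coreDrop_succ, coreDrop_succ]
        refine le_trans (le_of_eq ?_) hpos
        linear_combination (-(β ^ e * β⁻¹ ^ j)) * hinv
  have fv := barrier_outside (β := β) (M := M) hent hcore
  by_cases hanchor : R y ∧ x = d
  · obtain ⟨hR, rfl⟩ := hanchor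
    have hmod := hR3 _ hR
    have f0 : barrier β R M x e c (x, y) = 0 := by
      rw [fv, if_neg]
      rintro (h | h)
      · exact hRM _ hR h
      · omega
    have hn : ∀ x', barrier β R M x e c (x', y) = if M y ∨ x < x' then 1 else 0 := by
      intro x'
      apply barrier_outside <;> rintro ⟨h, -⟩ <;> have := hR3 _ h <;> omega
    have f1 : barrier β R M x e c (x + 1, y) = 1 := by
      rw [hn, if_pos (Or.inr (by omega))]
    have f2 : barrier β R M x e c (x - 1, y) = 0 := by
      rw [hn, if_neg]
      rintro (h | h)
      · exact hRM _ hR h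
      · omega
    have f3 := barrier_entrance (β := β) (M := M) (c := c) (i := 0) (e := e) (x := x)
        (y := y + 1) (d := x) (R := R) (by convert hR using 1; ring) (by omega) (by omega)
    have k4 : ¬ s(((x, y - 1) : V), (x, y - 1 + 1)) ∈ G := by
      intro h
      rcases hV x (y - 1) h (by omega) with h | h | h
      · omega
      · have := hR3 _ h.2; omega
      · omega
    rw [if_neg k4, if_pos (hE3 y hR), f0, f1, f2, f3]
    simp only [entDrop, Finset.range_zero, Finset.sum_empty]
    refine le_trans ?_ hpos
    split_ifs <;> linarith
  · refine le_trans ?_ hpos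
    have key : ∀ a b c d : ℝ, a ≤ 0 → b ≤ 0 → c ≤ 0 → d ≤ 0 → a + b + c + d ≤ 0 := by
      intros; linarith
    refine key _ _ _ _ ?_ ?_ ?_ ?_
    · refine ite_le_zero fun h => mul_nonpos_of_nonneg_of_nonpos (by linarith) (sub_nonpos.2 ?_)
      have hz := hH x y h
      rw [fv, barrier_outside]
      · refine ite_le_ite_of_imp ?_
        rintro (h' | h')
        · exact .inl h'
        · by_contra hcon
          rw [not_or] at hcon
          rcases hz (by omega) (by omega) with (hz | hz) | hz | hz
          · exact hanchor ⟨hz, by omega⟩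
          · exact hcon.1 hz
          · omega
          · exact hcore ⟨hz.1, by omega, by omega⟩
      · rintro ⟨hR, h1, h2⟩
        have hmod := hR3 _ hR
        rcases hz (by omega) (by omega) with (hz | hz) | hz | hz
        · have := hR3 _ hz; omega
        · have := hM3 _ hz; omega
        · exact hent ⟨hR, by omega, by omega⟩
        · have := hR3 _ hz.1; omega
      · rintro ⟨hR, h1, h2⟩
        have hmod := hR3 _ hR
        rcases hz (by omega) (by omega) with (hz | hz) | hz | hz
        · have := hR3 _ hz; omega
        · have := hM3 _ hz; omega
        · have := hR3 _ hz.1; omega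
        · exact hcore ⟨hR, by omega, by omega⟩
    · refine ite_le_zero fun h => sub_nonpos.2 ?_
      have hz := hH (x - 1) y h
      rw [fv, barrier_outside]
      · refine ite_le_ite_of_imp ?_
        rintro (h' | h')
        · exact .inl h'
        · exact .inr (by omega)
      · rintro ⟨hR, h1, h2⟩
        have hmod := hR3 _ hR
        rcases hz (by omega) (by omega) with (hz | hz) | hz | hz
        · have := hR3 _ hz; omega
        · have := hM3 _ hz; omega
        · exact hent ⟨hR, by omega, by omega⟩
        · have := hR3 _ hz.1; omega
      · rintro ⟨hR, h1, h2⟩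
        have hmod := hR3 _ hR
        rcases hz (by omega) (by omega) with (hz | hz) | hz | hz
        · have := hR3 _ hz; omega
        · have := hM3 _ hz; omega
        · have := hR3 _ hz.1; omega
        · exact hcore ⟨hR, by omega, by omega⟩
    · refine ite_le_zero fun h => sub_nonpos.2 ?_
      have hz := hV x y h
      rw [fv, barrier_outside]
      · refine ite_le_ite_of_imp ?_
        rintro (h' | h')
        · by_contra hcon
          rw [not_or] at hcon
          rcases hz (by omega) with hz | hz | hz
          · exact hz.2.2 h'
          · exact hanchor ⟨hz.2, hz.1⟩
          · exact hent ⟨hz.2, by omega, by omega⟩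
        · exact .inr h'
      · rintro ⟨hR, h1, h2⟩
        rw [add_sub_cancel_right] at hR
        have hmod := hR3 _ hR
        rcases hz (by omega) with hz | hz | hz
        · omega
        · exact hanchor ⟨hz.2, hz.1⟩
        · have := hR3 _ hz.2; omega
      · rintro ⟨hR, h1, h2⟩
        have hmod := hR3 _ hR
        rcases hz (by omega) with hz | hz | hz
        · omega
        · have := hR3 _ hz.2; omega
        · exact hent ⟨hz.2, by omega, by omega⟩
    · refine ite_le_zero fun h => sub_nonpos.2 ?_
      have hz := hV x (y - 1) h
      rw [fv, barrier_outside]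
      · refine ite_le_ite_of_imp ?_
        rintro (h' | h')
        · by_contra hcon
          rw [not_or] at hcon
          rcases hz (by omega) with hz | hz | hz
          · exact hz.2.1 h'
          · exact hent ⟨hz.2, by omega, by omega⟩
          · have := hR3 _ hz.2; have := hM3 _ h'; omega
        · exact .inr h'
      · rintro ⟨hR, h1, h2⟩
        have hmod := hR3 _ hR
        rcases hz (by omega) with hz | hz | hz
        · omega
        · have := hR3 _ hz.2; omega
        · refine hcore ⟨?_, by omega, by omega⟩
          convert hz.2 using 1
          ring
      · rintro ⟨hR, h1, h2⟩
        have hmod := hR3 _ hR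
        rcases hz (by omega) with hz | hz | hz
        · omega
        · have := hR3 _ hz.2; omega
        · have := hR3 _ hz.2; omega

lemma entDrop_le (hβ : 1 < β) {i e : ℕ} (hi : i ≤ e) : entDrop β i ≤ coreDrop β e 0 := by
  unfold coreDrop entDrop
  have : ∑ t ∈ Finset.range i, β ^ (t + 1) ≤ ∑ t ∈ Finset.range e, β ^ (t + 1) :=
    Finset.sum_le_sum_of_subset_of_nonneg (Finset.range_subset_range.2 hi) fun _ _ _ => by
      positivity
  have h2 : 0 ≤ β ^ (e + 1) := by positivity
  simp only [Finset.range_zero, Finset.sum_empty]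
  linarith

lemma coreDrop_le (hβ : 1 < β) (e i : ℕ) : coreDrop β e i ≤ 2 * β ^ 2 / (β - 1) * β ^ e := by
  have hb : 0 < β - 1 := by linarith
  have hβ0 : β ≠ 0 := by positivity
  have h1 : ∑ t ∈ Finset.range e, β ^ (t + 1) = β * (β ^ e - 1) / (β - 1) := by
    rw [mul_div_assoc, ← geom_sum_eq hβ.ne', Finset.mul_sum]
    exact Finset.sum_congr rfl fun t _ => by ring
  have h2 : ∑ t ∈ Finset.range i, β⁻¹ ^ t ≤ β / (β - 1) := by
    have h1 : β⁻¹ < 1 := inv_lt_one_of_one_lt₀ hβ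
    have h0 : 0 ≤ β⁻¹ := by positivity
    refine ((summable_geometric_of_lt_one h0 h1).sum_le_tsum _ fun _ _ => by positivity).trans ?_
    rw [tsum_geometric_of_lt_one h0 h1]
    apply le_of_eq
    field_simp
  have h3 : 1 ≤ β ^ e := one_le_pow₀ hβ.le
  unfold coreDrop entDrop
  rw [h1, ← Finset.mul_sum]
  calc _ ≤ β + β * (β ^ e - 1) / (β - 1) + β ^ (e + 1) + β ^ e * (β / (β - 1)) := by gcongr
    _ ≤ _ := by
      rw [← sub_nonneg]
      have : 2 * β ^ 2 / (β - 1) * β ^ e -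
          (β + β * (β ^ e - 1) / (β - 1) + β ^ (e + 1) + β ^ e * (β / (β - 1))) =
          β * (β * β ^ e - (β ^ e + β - 2)) / (β - 1) := by
        field_simp
        ring
      rw [this]
      apply div_nonneg _ hb.le
      apply mul_nonneg (by linarith)
      nlinarith

lemma neg_le_barrier (hβ : 1 < β) (v : V) :
    -(2 * β ^ 2 / (β - 1) * β ^ e) ≤ barrier β R M d e c v := by
  have h0 : 0 ≤ 2 * β ^ 2 / (β - 1) * β ^ e := by
    have : 0 < β - 1 := by linarith
    positivity
  unfold barrier
  split_ifs with h1
  · exact neg_le_neg ((entDrop_le hβ (by omega)).trans (coreDrop_le hβ e 0))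
  · exact neg_le_neg (coreDrop_le hβ e _)
  · linarith
  · linarith

end barrier

/-- The barrier function of the traps on the order-`(n + 1)` branches with tip on the `y`-axis. -/
def trapBarrier (γ β : ℝ) (n : ℕ) : V → ℝ :=
  barrier β (fun y => ∃ l, Odd l ∧ y = rowY (n + 1) l) (fun y => (3 * 2 ^ (n + 1) : ℤ) ∣ y)
    (anchorX (n + 1) 0) (eF γ (n + 1)) (cF (n + 1))

lemma branchTrap_subset {γ : ℝ} {k : ℕ} (hk : 2 ≤ k) {l : ℤ} (hl : Odd l) :
    branchTrap γ k l 0 ⊆ etaEdges γ := fun _ hf => .inr ⟨k, l, 0, hk, hl, .zero k, hf⟩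

lemma gen_trapBarrier_le {γ β : ℝ} (hγ : 1 < γ) (hβ : 1 < β) {n : ℕ} (hn : 2 ≤ n) (v : V) :
    gen β (etaEdges γ) (trapBarrier γ β n) v ≤
      β ^ (eF γ (n + 1) + 1) * β⁻¹ ^ cF (n + 1) := by
  have ha := le_anchorX (k := n + 1) (by omega) 0
  have hb := bF_eq_cF n
  have hc3 : cF 3 ≤ cF (n + 1) := cF_mono (by omega)
  have hc3' : cF 3 = 3 := by decide
  have he := one_le_eF hγ (k := n + 1) (by omega)
  rw [Nat.add_sub_cancel] at ha
  refine gen_barrier_le hβ he (eF_le γ _) (by omega) ?_ ?_ ?_ ?_ ?_ ?_ ?_ ?_ ?_ v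
  · rintro _ ⟨l, _, rfl⟩
    exact rowY_zmod _ _
  · exact fun y hy => (dvd_mul_right _ _).trans hy
  · rintro _ ⟨l, hl, rfl⟩
    exact not_dvd_rowY (by omega) le_rfl hl
  · intro x y h h1 h2
    exact (HKind.of_mem h).zone (by omega) (by omega)
  · intro x y h h1
    rcases (VKind.of_mem h).left (n := n) (by omega) with h | h
    · exact .inl ⟨by omega, h.2⟩
    · exact .inr h
  · rintro x y ⟨l, hl, hy⟩ h1 h2
    refine branchTrap_subset (k := n + 1) (by omega) hl
      (.inl (.inr ⟨(x - (anchorX (n + 1) 0 - eF γ (n + 1))).toNat, by omega, ?_⟩))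
    congr 2 <;> congr 1 <;> omega
  · rintro x y ⟨l, hl, hy⟩ h1 h2
    refine branchTrap_subset (k := n + 1) (by omega) hl
      (.inr ⟨(x - (anchorX (n + 1) 0 - eF γ (n + 1))).toNat, by omega, ?_⟩)
    congr 2 <;> congr 1 <;> omega
  · rintro y ⟨l, hl, rfl⟩
    exact branchTrap_subset (k := n + 1) (by omega) hl (.inl (.inl (.inl rfl)))
  · rintro y ⟨l, hl, hy⟩
    refine branchTrap_subset (k := n + 1) (by omega) hl (.inl (.inl (.inr ?_)))
    rw [Set.mem_singleton_iff, show rowY (n + 1) l + 2 = y + 1 by omega, ← hy, sub_add_cancel]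

section trapBarrier

variable {γ β : ℝ} {n : ℕ} {v : V}

lemma trapBarrier_nonneg (hn : 1 ≤ n) (hv : v.1 < bF n ∨ (bF (n + 1) : ℤ) ≤ v.1) :
    0 ≤ trapBarrier γ β n v := by
  classical
  have ha := le_anchorX (k := n + 1) (by omega) 0
  have he := eF_le γ (n + 1)
  have hc := cF_pos (n + 1)
  rw [Nat.add_sub_cancel] at ha
  obtain ⟨x, y⟩ := v
  dsimp only at hv
  rw [trapBarrier, barrier_outside]
  · split_ifs <;> norm_num
  · rintro ⟨-, h1, h2⟩; omega
  · rintro ⟨-, h1, h2⟩; omega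

lemma trapBarrier_eq_one (hn : 1 ≤ n) (hv : (bF (n + 1) : ℤ) ≤ v.1) :
    trapBarrier γ β n v = 1 := by
  classical
  have ha := le_anchorX (k := n + 1) (by omega) 0
  have he := eF_le γ (n + 1)
  have hc := cF_pos (n + 1)
  obtain ⟨x, y⟩ := v
  dsimp only at hv
  rw [trapBarrier, barrier_outside, if_pos (Or.inr (by omega))]
  · rintro ⟨-, h1, h2⟩; omega
  · rintro ⟨-, h1, h2⟩; omega

lemma trapBarrier_eq_zero (hn : 1 ≤ n) (hv : v.1 < bF n) {l : ℤ} (hl : Odd l)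
    (hy : v.2 = rowY 1 l) : trapBarrier γ β n v = 0 := by
  classical
  have ha := le_anchorX (k := n + 1) (by omega) 0
  have he := eF_le γ (n + 1)
  have hc := cF_pos (n + 1)
  rw [Nat.add_sub_cancel] at ha
  obtain ⟨x, y⟩ := v
  dsimp only at hv hy
  subst hy
  rw [trapBarrier, barrier_outside, if_neg]
  · rintro (h | h)
    · exact not_dvd_rowY le_rfl (by omega : 1 ≤ n + 1) hl h
    · omega
  · rintro ⟨-, h1, h2⟩; omega
  · rintro ⟨-, h1, h2⟩; omega

end trapBarrier

/-- The superposition of the barriers of orders `j + 1, …, 2 j + 1`. -/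
def multiBarrier (γ β κ : ℝ) (j : ℕ) (v : V) : ℝ :=
  1 + κ * ∑ n ∈ Finset.Icc j (2 * j), trapBarrier γ β n v

lemma gen_multiBarrier (γ β κ : ℝ) (j : ℕ) (G : Set (Sym2 V)) (v : V) :
    gen β G (multiBarrier γ β κ j) v =
      κ * ∑ n ∈ Finset.Icc j (2 * j), gen β G (trapBarrier γ β n) v := by
  classical
  unfold gen
  rw [Finset.sum_comm, Finset.mul_sum]
  refine Finset.sum_congr rfl fun w _ => ?_
  unfold multiBarrier
  split_ifs
  · rw [← Finset.mul_sum, Finset.sum_sub_distrib]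
    ring
  · simp

section multiBarrier

variable {γ β κ : ℝ} {j : ℕ}

lemma half_le_multiBarrier (hβ : 1 < β) (hκ : 0 ≤ κ) (hj : 1 ≤ j)
    (hκe : ∀ n ∈ Finset.Icc j (2 * j), κ * (2 * β ^ 2 / (β - 1) * β ^ eF γ (n + 1)) ≤ 1 / 2)
    (v : V) : 1 / 2 ≤ multiBarrier γ β κ j v := by
  unfold multiBarrier
  by_cases h : ∃ m ∈ Finset.Icc j (2 * j), (bF m : ℤ) ≤ v.1 ∧ v.1 < bF (m + 1)
  · obtain ⟨m, hm, h1, h2⟩ := h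
    rw [← Finset.add_sum_erase _ _ hm]
    have hs : 0 ≤ ∑ n ∈ (Finset.Icc j (2 * j)).erase m, trapBarrier γ β n v := by
      refine Finset.sum_nonneg fun n hn => ?_
      rw [Finset.mem_erase, Finset.mem_Icc] at hn
      refine trapBarrier_nonneg (by omega) ?_
      rcases lt_or_gt_of_ne hn.1 with hlt | hlt
      · have := bF_mono (show n + 1 ≤ m by omega)
        right; omega
      · have := bF_mono (show m + 1 ≤ n by omega)
        left; omega
    have h3 := mul_le_mul_of_nonneg_left (neg_le_barrier (e := eF γ (m + 1)) (c := cF (m + 1))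
      (d := anchorX (m + 1) 0) (R := fun y => ∃ l, Odd l ∧ y = rowY (m + 1) l)
      (M := fun y => (3 * 2 ^ (m + 1) : ℤ) ∣ y) hβ v) hκ
    change _ ≤ κ * trapBarrier γ β m v at h3
    have h4 := mul_nonneg hκ hs
    have h5 := hκe m hm
    linarith
  · have hs : 0 ≤ ∑ n ∈ Finset.Icc j (2 * j), trapBarrier γ β n v := by
      refine Finset.sum_nonneg fun n hn => ?_
      refine trapBarrier_nonneg (hj.trans (Finset.mem_Icc.1 hn).1) ?_
      by_contra hcon
      exact h ⟨n, hn, by omega, by omega⟩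
    have := mul_nonneg hκ hs
    linarith

lemma gen_multiBarrier_le (hγ : 1 < γ) (hβ : 1 < β) (hκ : 0 ≤ κ) (hj : 2 ≤ j)
    (hκe : ∀ n ∈ Finset.Icc j (2 * j), κ * (2 * β ^ 2 / (β - 1) * β ^ eF γ (n + 1)) ≤ 1 / 2)
    (v : V) : gen β (etaEdges γ) (multiBarrier γ β κ j) v ≤
      ((j + 1 : ℕ) * β⁻¹ ^ cF (j + 1)) * multiBarrier γ β κ j v := by
  have hb : 0 < β - 1 := by linarith
  have hh := half_le_multiBarrier hβ hκ (by omega) hκe v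
  rw [gen_multiBarrier, Finset.mul_sum]
  have hterm : ∀ n ∈ Finset.Icc j (2 * j), κ * gen β (etaEdges γ) (trapBarrier γ β n) v ≤
      β⁻¹ ^ cF (j + 1) * (1 / 2) := by
    intro n hn
    have hn' := Finset.mem_Icc.1 hn
    have hp : 0 ≤ κ * β ^ eF γ (n + 1) := by positivity
    have h1 : β ≤ 2 * β ^ 2 / (β - 1) := by
      rw [le_div_iff₀ hb]; nlinarith
    calc _ ≤ κ * (β ^ (eF γ (n + 1) + 1) * β⁻¹ ^ cF (n + 1)) :=
          mul_le_mul_of_nonneg_left (gen_trapBarrier_le hγ hβ (by omega) v) hκ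
      _ = (κ * β ^ eF γ (n + 1) * β) * β⁻¹ ^ cF (n + 1) := by ring
      _ ≤ (κ * β ^ eF γ (n + 1) * (2 * β ^ 2 / (β - 1))) * β⁻¹ ^ cF (j + 1) := by
          gcongr ?_ * ?_
          · gcongr
          · exact pow_le_pow_of_le_one (by positivity) (inv_le_one_of_one_le₀ hβ.le)
              (cF_mono (by omega))
      _ = κ * (2 * β ^ 2 / (β - 1) * β ^ eF γ (n + 1)) * β⁻¹ ^ cF (j + 1) := by ring
      _ ≤ 1 / 2 * β⁻¹ ^ cF (j + 1) := by gcongr; exact hκe n hn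
      _ = _ := by ring
  calc _ ≤ ∑ n ∈ Finset.Icc j (2 * j), β⁻¹ ^ cF (j + 1) * (1 / 2) := Finset.sum_le_sum hterm
    _ = ((j + 1 : ℕ) * β⁻¹ ^ cF (j + 1)) * (1 / 2) := by
      rw [Finset.sum_const, Nat.card_Icc, show 2 * j + 1 - j = j + 1 by omega, nsmul_eq_mul]
      ring
    _ ≤ _ := by gcongr

/-- Before time `T` the walk is unlikely to cross all traps of orders `j + 1, …, 2 j + 1`. -/
lemma measure_cross_le (hγ : 1 < γ) (hβ : 1 < β) (hκ : 0 ≤ κ) (hj : 2 ≤ j)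
    (hκe : ∀ n ∈ Finset.Icc j (2 * j), κ * (2 * β ^ 2 / (β - 1) * β ^ eF γ (n + 1)) ≤ 1 / 2)
    {z : V} {μ : Measure (ℕ → V)} (hμ : IsWalkLaw β (etaEdges γ) z μ)
    (hz : z.1 < bF j) {l : ℤ} (hl : Odd l) (hy : z.2 = rowY 1 l) {T : ℕ}
    (hT : T * ((j + 1 : ℕ) * β⁻¹ ^ cF (j + 1)) ≤ 1) :
    μ {ω | ∃ t ≤ T, (bF (2 * j + 1) : ℤ) ≤ (ω t).1} ≤
      ENNReal.ofReal (Real.exp 1 / (1 + κ * (j + 1 : ℕ))) := by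
  set δ : ℝ := (j + 1 : ℕ) * β⁻¹ ^ cF (j + 1) with hδ
  set A : ℝ := 1 + κ * (j + 1 : ℕ) with hA
  have hδ0 : 0 ≤ δ := by positivity
  have hA0 : 0 < A := by positivity
  have hpos : ∀ v, 0 ≤ multiBarrier γ β κ j v := fun v => by
    have := half_le_multiBarrier hβ hκ (by omega) hκe v
    linarith
  have hgen : ∀ v, gen β (etaEdges γ) (fun w => multiBarrier γ β κ j w / A) v ≤
      δ * (multiBarrier γ β κ j v / A) := by
    intro v
    have h := gen_multiBarrier_le hγ hβ hκ hj hκe v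
    have e : gen β (etaEdges γ) (fun w => multiBarrier γ β κ j w / A) v =
        gen β (etaEdges γ) (multiBarrier γ β κ j) v / A := by
      unfold gen
      rw [Finset.sum_div]
      refine Finset.sum_congr rfl fun w _ => ?_
      split_ifs <;> ring
    rw [e, ← mul_div_assoc]
    gcongr
  have key := measure_hit_le hβ hμ (h := fun v => ENNReal.ofReal (multiBarrier γ β κ j v / A))
    (D := {v | (bF (2 * j + 1) : ℤ) ≤ v.1}) (q := ENNReal.ofReal (1 + δ)) ?_ ?_ ?_ T
  · refine key.trans ?_
    have hz1 : multiBarrier γ β κ j z = 1 := by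
      unfold multiBarrier
      rw [Finset.sum_eq_zero, mul_zero, add_zero]
      intro n hn
      have hn := Finset.mem_Icc.1 hn
      have := bF_mono hn.1
      exact trapBarrier_eq_zero (by omega) (by omega) hl hy
    rw [hz1, ← ENNReal.ofReal_pow (by positivity), ← ENNReal.ofReal_mul (by positivity)]
    refine ENNReal.ofReal_le_ofReal ?_
    rw [mul_one_div]
    gcongr
    calc (1 + δ) ^ T ≤ Real.exp δ ^ T := by
          gcongr
          rw [add_comm]
          exact Real.add_one_le_exp δ
      _ = Real.exp (T * δ) := (Real.exp_nat_mul δ T).symm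
      _ ≤ _ := Real.exp_le_exp.2 hT
  · intro v hv
    rw [Set.mem_ofPred_eq] at hv
    rw [ENNReal.one_le_ofReal, one_le_div hA0]
    unfold multiBarrier
    rw [Finset.sum_congr rfl (g := fun _ => 1), Finset.sum_const, Nat.card_Icc,
      show 2 * j + 1 - j = j + 1 by omega, nsmul_eq_mul, mul_one]
    intro n hn
    have hn := Finset.mem_Icc.1 hn
    have := bF_mono (show n + 1 ≤ 2 * j + 1 by omega)
    exact trapBarrier_eq_one (by omega) (by omega)
  · rw [ENNReal.one_le_ofReal]
    linarith
  · exact fun v => tsum_transProb_le hβ mem_nbrs_of_mem_etaEdges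
      (fun w => div_nonneg (hpos w) hA0.le) hδ0 v (hgen v)

end multiBarrier

lemma nonneg_of_mem_etaEdges {γ : ℝ} {v w : V} (h : s(v, w) ∈ etaEdges γ) : 0 ≤ v.1 := by
  have ha : ∀ {k : ℕ} {t : ℤ}, 2 ≤ k → IsTip k t → 0 ≤ anchorX k t - eF γ k := by
    intro k t hk ht
    have := le_anchorX hk t
    have := ht.nonneg
    have := eF_le γ k
    omega
  have key : ∃ x y : ℤ, 0 ≤ x ∧ (s(v, w) = s((x, y), (x + 1, y)) ∨
      s(v, w) = s((x, y), (x, y + 1))) := by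
    rcases etaEdges_kind h with ⟨x, y, he, hk⟩ | ⟨x, y, he, hk⟩
    · refine ⟨x, y, ?_, .inl he⟩
      rcases hk with ⟨k, l, t, hk, hl, ht, hh⟩ | ⟨k, l, t, hk, hl, ht, hh⟩
      · have := ht.nonneg
        omega
      · have := ha hk ht
        omega
    · refine ⟨x, y, ?_, .inr he⟩
      rcases hk with ⟨k, t, p, hk, ht, hh⟩ | ⟨k, l, t, hk, hl, ht, hh⟩
      · have := ht.nonneg
        have := bF_pos k
        omega
      · have := ha hk ht
        omega
  obtain ⟨x, y, hx, he | he⟩ := key <;>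
  · obtain ⟨a, b⟩ := v
    obtain ⟨a', b'⟩ := w
    rw [Sym2.eq_iff] at he
    simp only [Prod.mk.injEq] at he
    dsimp only
    omega

lemma ae_nonneg {γ β : ℝ} (hβ : 1 < β) {z : V} (hz : 0 ≤ z.1)
    {μ : Measure (ℕ → V)} (hμ : IsWalkLaw β (etaEdges γ) z μ) :
    ∀ᵐ ω ∂μ, ∀ t, 0 ≤ (ω t).1 := by
  rw [ae_all_iff]
  intro T
  rw [ae_iff]
  have key := measure_hit_le hβ hμ
    (h := fun v => ENNReal.ofReal (if v.1 < 0 then 1 else 0))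
    (D := {v | v.1 < 0}) (q := ENNReal.ofReal (1 + 0)) ?_ ?_ ?_ T
  · rw [if_neg (by omega), ENNReal.ofReal_zero, mul_zero] at key
    refine measure_mono_null ?_ (le_antisymm key zero_le)
    intro ω hω
    exact ⟨T, le_rfl, not_le.1 hω⟩
  · intro v hv
    rw [Set.mem_ofPred_eq] at hv
    simp [hv]
  · simp
  · refine fun v => tsum_transProb_le hβ mem_nbrs_of_mem_etaEdges
      (F := fun v => if v.1 < 0 then 1 else 0) (fun w => by split_ifs <;> norm_num) le_rfl v ?_
    classical
    rw [zero_mul]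
    unfold gen
    refine Finset.sum_nonpos fun w _ => ?_
    by_cases h : s(v, w) ∈ etaEdges γ
    · have hv := nonneg_of_mem_etaEdges h
      have hw := nonneg_of_mem_etaEdges (Sym2.eq_swap ▸ h : s(w, v) ∈ etaEdges γ)
      simp [not_lt.2 hv, not_lt.2 hw]
    · simp [h]

lemma le_bF (k : ℕ) : k ≤ bF k := by
  induction k with
  | zero => exact Nat.zero_le _
  | succ k ih =>
    rcases k.eq_zero_or_pos with rfl | hk
    · exact bF_pos _
    · have := three_mul_bF_le hk
      have := bF_pos k
      omega

/-- The weight with which the trap barriers of orders `j + 1, …, 2 j + 1` are superposed. -/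
def barrierWeight (γ β : ℝ) (j : ℕ) : ℝ :=
  (β - 1) / (4 * β ^ 3 * (2 * j + 1 : ℝ) ^ (Real.log β / Real.log γ))

lemma barrierWeight_pos {γ β : ℝ} (hβ : 1 < β) (j : ℕ) : 0 < barrierWeight γ β j := by
  unfold barrierWeight
  have : 0 < β - 1 := by linarith
  positivity

lemma pow_eF_le {γ β : ℝ} (hγ : 1 < γ) (hβ : 1 < β) {k m : ℕ} (hk : 1 ≤ k) (hkm : k ≤ m) :
    β ^ eF γ k ≤ β * (m : ℝ) ^ (Real.log β / Real.log γ) := by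
  have hlγ := Real.log_pos hγ
  have hβ0 : 0 < β := by linarith
  have hk' : (1 : ℝ) ≤ k := by exact_mod_cast hk
  have hkm' : (k : ℝ) ≤ m := by exact_mod_cast hkm
  have h1 : (eF γ k : ℝ) ≤ Real.log m / Real.log γ + 1 := by
    have h2 : (eF γ k : ℝ) ≤ (⌈Real.log k / Real.log γ⌉₊ : ℝ) := by
      exact_mod_cast min_le_left _ _
    have h3 := (Nat.ceil_lt_add_one (div_nonneg (Real.log_nonneg hk') hlγ.le)).le
    have h4 : Real.log k / Real.log γ ≤ Real.log m / Real.log γ := by gcongr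
    linarith
  calc β ^ eF γ k = β ^ (eF γ k : ℝ) := (Real.rpow_natCast _ _).symm
    _ ≤ β ^ (Real.log m / Real.log γ + 1) := Real.rpow_le_rpow_of_exponent_le hβ.le h1
    _ = β * β ^ (Real.log m / Real.log γ) := by
      rw [Real.rpow_add_one hβ0.ne', mul_comm]
    _ = _ := by
      rw [Real.rpow_def_of_pos hβ0, Real.rpow_def_of_pos (by linarith)]
      ring_nf

lemma barrierWeight_mul_le {γ β : ℝ} (hγ : 1 < γ) (hβ : 1 < β) {j n : ℕ} (hn : n ≤ 2 * j) :
    barrierWeight γ β j * (2 * β ^ 2 / (β - 1) * β ^ eF γ (n + 1)) ≤ 1 / 2 := by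
  have h := pow_eF_le hγ hβ (show 1 ≤ n + 1 by omega) (show n + 1 ≤ 2 * j + 1 by omega)
  have hb : 0 < β - 1 := by linarith
  have hp : 0 < (2 * j + 1 : ℝ) ^ (Real.log β / Real.log γ) := by positivity
  push_cast at h
  calc _ ≤ barrierWeight γ β j * (2 * β ^ 2 / (β - 1) *
        (β * (2 * j + 1 : ℝ) ^ (Real.log β / Real.log γ))) := by
        have := (barrierWeight_pos (γ := γ) hβ j).le
        gcongr
    _ = 1 / 2 := by
      unfold barrierWeight
      field_simp
      norm_num

lemma rpow_le_barrierWeight_mul {γ β : ℝ} (hγ : 1 < γ) (hβ : 1 < β) (hβγ : β < γ) (i : ℕ) :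
    (β - 1) / (8 * β ^ 3) * ((2 : ℝ) ^ (1 - Real.log β / Real.log γ)) ^ i ≤
      barrierWeight γ β (2 ^ i) * (2 ^ i + 1 : ℕ) := by
  have hb : 0 < β - 1 := by linarith
  set a := Real.log β / Real.log γ with ha
  have ha1 : a < 1 := (div_lt_one (Real.log_pos hγ)).2 (Real.log_lt_log (by linarith) hβγ)
  set m : ℝ := 2 * 2 ^ i + 1 with hm
  have hm0 : 0 < m := by positivity
  have h1 : ((2 : ℝ) ^ (1 - a)) ^ i ≤ m ^ (1 - a) := by
    rw [← Real.rpow_natCast, ← Real.rpow_mul (by norm_num), mul_comm,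
      Real.rpow_mul (by norm_num), Real.rpow_natCast]
    refine Real.rpow_le_rpow (by positivity) ?_ (by linarith)
    have : (0 : ℝ) < 2 ^ i := by positivity
    linarith
  rw [Real.rpow_sub hm0, Real.rpow_one] at h1
  have hp : 0 < m ^ a := by positivity
  calc _ ≤ (β - 1) / (8 * β ^ 3) * (m / m ^ a) := by gcongr
    _ = (β - 1) / (4 * β ^ 3 * m ^ a) * (m / 2) := by field_simp; norm_num
    _ ≤ (β - 1) / (4 * β ^ 3 * m ^ a) * (2 ^ i + 1 : ℕ) := by
      gcongr
      push_cast
      rw [hm]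
      linarith
    _ = _ := by
      unfold barrierWeight
      rw [← ha, hm]
      push_cast
      rfl

/-- The time before which the walk is unlikely to cross the traps of orders `j + 1, …`. -/
def crossTime (β : ℝ) (j : ℕ) : ℕ := ⌊β ^ cF (j + 1) / (j + 1 : ℕ)⌋₊

lemma crossTime_mul_le {β : ℝ} (hβ : 1 < β) (j : ℕ) :
    crossTime β j * ((j + 1 : ℕ) * β⁻¹ ^ cF (j + 1)) ≤ 1 := by
  have h : (crossTime β j : ℝ) ≤ β ^ cF (j + 1) / (j + 1 : ℕ) := Nat.floor_le (by positivity)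
  calc _ ≤ β ^ cF (j + 1) / (j + 1 : ℕ) * ((j + 1 : ℕ) * β⁻¹ ^ cF (j + 1)) := by gcongr
    _ = 1 := by
      rw [inv_pow]
      have : β ^ cF (j + 1) ≠ 0 := by positivity
      field_simp

/-- Almost surely the walk eventually needs longer than `crossTime` to cross the traps. -/
lemma ae_eventually_lt {γ β : ℝ} (hγ : 1 < γ) (hβ : 1 < β) (hβγ : β < γ)
    {z : V} {μ : Measure (ℕ → V)} (hμ : IsWalkLaw β (etaEdges γ) z μ)
    {l : ℤ} (hl : Odd l) (hy : z.2 = rowY 1 l) :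
    ∀ᵐ ω ∂μ, ∀ᶠ i : ℕ in atTop, ∀ t ≤ crossTime β (2 ^ i),
      (ω t).1 < (bF (2 * 2 ^ i + 1) : ℤ) := by
  have hb : 0 < β - 1 := by linarith
  set C := (β - 1) / (8 * β ^ 3) with hC
  have hC0 : 0 < C := by positivity
  set ρ : ℝ := 2 ^ (1 - Real.log β / Real.log γ) with hρ
  have hρ1 : 1 < ρ := by
    refine Real.one_lt_rpow (by norm_num) (sub_pos.2 ?_)
    exact (div_lt_one (Real.log_pos hγ)).2 (Real.log_lt_log (by linarith) hβγ)
  obtain ⟨N, hN⟩ : ∃ N : ℕ, ∀ i ≥ N, 1 ≤ i ∧ z.1 < bF (2 ^ i) := by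
    refine ⟨z.1.toNat + 1, fun i hi => ⟨by omega, ?_⟩⟩
    have h1 : i < 2 ^ i := Nat.lt_two_pow_self
    have := le_bF (2 ^ i)
    omega
  set S : ℕ → Set (ℕ → V) := fun i =>
    {ω | ∃ t ≤ crossTime β (2 ^ (i + N)), (bF (2 * 2 ^ (i + N) + 1) : ℤ) ≤ (ω t).1} with hS
  have hle : ∀ i, μ (S i) ≤ ENNReal.ofReal (Real.exp 1 / C * ρ⁻¹ ^ i) := by
    intro i
    obtain ⟨h1, h2⟩ := hN (i + N) (by omega)
    have hj : 2 ≤ 2 ^ (i + N) := le_self_pow₀ (by norm_num) (by omega)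
    refine (measure_cross_le hγ hβ (barrierWeight_pos (γ := γ) hβ (2 ^ (i + N))).le hj
      (fun n hn => barrierWeight_mul_le hγ hβ (Finset.mem_Icc.1 hn).2) hμ h2 hl hy
      (crossTime_mul_le hβ _)).trans (ENNReal.ofReal_le_ofReal ?_)
    have h3 := rpow_le_barrierWeight_mul hγ hβ hβγ (i + N)
    have h4 : ρ ^ i ≤ ρ ^ (i + N) := pow_le_pow_right₀ hρ1.le (by omega)
    have h5 : C * ρ ^ i ≤ C * ρ ^ (i + N) := by gcongr
    calc _ ≤ Real.exp 1 / (C * ρ ^ i) := by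
          gcongr
          linarith
      _ = _ := by rw [inv_pow]; field_simp
  have hsum : ∑' i, μ (S i) ≠ ⊤ := by
    refine ne_top_of_le_ne_top ?_ (ENNReal.tsum_le_tsum hle)
    rw [← ENNReal.ofReal_tsum_of_nonneg (fun i => by positivity)]
    · exact ENNReal.ofReal_ne_top
    · exact (summable_geometric_of_lt_one (by positivity) (inv_lt_one_of_one_lt₀ hρ1)).mul_left _
  filter_upwards [ae_eventually_notMem hsum] with ω hω
  rw [← map_add_atTop_eq_nat N, eventually_map]
  filter_upwards [hω] with i hi t ht
  by_contra hcon
  exact hi ⟨t, ht, not_lt.1 hcon⟩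

lemma cF_succ_ge {j : ℕ} (hj : 3 ≤ j) : 3 ^ j ≤ cF (j + 1) := by
  unfold cF
  refine Nat.pow_le_pow_right (by norm_num) ?_
  rw [Nat.le_div_iff_mul_le (by norm_num), Nat.add_sub_cancel,
    show j + 1 - 2 = j - 1 by omega]
  exact Nat.mul_le_mul_left _ (by omega)

lemma eventually_mul_bF_le_crossTime {β : ℝ} (hβ : 1 < β) (A : ℕ) :
    ∀ᶠ j : ℕ in atTop, A * bF (4 * j + 1) ≤ crossTime β j := by
  have hlβ := Real.log_pos hβ
  have hl3 : 0 < Real.log 3 := Real.log_pos (by norm_num)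
  have h1 := (tendsto_pow_const_div_const_pow_of_one_lt 2 (show (1 : ℝ) < 3 by norm_num))
    |>.eventually_le_const (show 0 < Real.log β / (12 * Real.log 3) by positivity)
  filter_upwards [h1, eventually_ge_atTop (A + 3)] with j hj hjA
  have hj3 := cF_succ_ge (show 3 ≤ j by omega)
  have hjp : j + 1 ≤ 3 ^ j := Nat.lt_pow_self (by norm_num)
  have hAj : 4 * A ≤ 3 ^ (j * j) := by
    have h : 4 * A ≤ 3 ^ (A + 2) := by
      have : A < 3 ^ A := Nat.lt_pow_self (by norm_num)
      rw [pow_add]; omega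
    exact h.trans (Nat.pow_le_pow_right (by norm_num) (by nlinarith))
  have hexp : (4 * j + 1) * (4 * j + 1 - 1) / 2 + j * j + j ≤ 12 * j ^ 2 := by
    have : (4 * j + 1) * (4 * j + 1 - 1) / 2 = (4 * j + 1) * (2 * j) := by
      rw [Nat.add_sub_cancel, show (4 * j + 1) * (4 * j) = (4 * j + 1) * (2 * j) * 2 by ring]
      exact Nat.mul_div_cancel _ (by norm_num)
    rw [this]
    nlinarith
  have hnat : A * bF (4 * j + 1) * (j + 1) ≤ 3 ^ (12 * j ^ 2) := by
    calc A * bF (4 * j + 1) * (j + 1) =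
          3 ^ ((4 * j + 1) * (4 * j + 1 - 1) / 2) * (4 * A) * (j + 1) := by
          unfold bF; ring
      _ ≤ 3 ^ ((4 * j + 1) * (4 * j + 1 - 1) / 2) * 3 ^ (j * j) * 3 ^ j := by gcongr
      _ = 3 ^ ((4 * j + 1) * (4 * j + 1 - 1) / 2 + j * j + j) := by rw [pow_add, pow_add]
      _ ≤ _ := Nat.pow_le_pow_right (by norm_num) hexp
  have hreal : (3 : ℝ) ^ (12 * j ^ 2) ≤ β ^ 3 ^ j := by
    rw [← Real.log_le_log_iff (by positivity) (by positivity), Real.log_pow, Real.log_pow]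
    rw [div_le_div_iff₀ (by positivity) (by positivity)] at hj
    push_cast
    linarith
  refine Nat.le_floor ?_
  rw [le_div_iff₀ (by positivity)]
  calc ((A * bF (4 * j + 1) : ℕ) : ℝ) * (j + 1 : ℕ) ≤ 3 ^ (12 * j ^ 2) := by exact_mod_cast hnat
    _ ≤ β ^ 3 ^ j := hreal
    _ ≤ β ^ cF (j + 1) := pow_le_pow_right₀ hβ.le hj3

lemma exists_le_lt_bF {M n : ℕ} (hn : bF (2 * 2 ^ M + 1) ≤ n) :
    ∃ i ≥ M, bF (2 * 2 ^ i + 1) ≤ n ∧ n ≤ bF (4 * 2 ^ i + 1) := by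
  by_contra! hcon
  have h : ∀ i, M ≤ i → bF (2 * 2 ^ i + 1) ≤ n := by
    intro i hi
    induction i, hi using Nat.le_induction with
    | base => exact hn
    | succ i hi ih =>
      have := hcon i hi ih
      rw [show 2 * 2 ^ (i + 1) = 4 * 2 ^ i by ring]
      exact this.le
  have h1 := h (n + M) (by omega)
  have h2 : n + M < 2 ^ (n + M) := Nat.lt_two_pow_self
  have := le_bF (2 * 2 ^ (n + M) + 1)
  omega

/-- If the walk needs at least time `crossTime` to cross, the time to reach `n` is superlinear. -/
lemma superlinear_of_eventually_lt {β : ℝ} (hβ : 1 < β) {ω : ℕ → V}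
    (hω : ∀ᶠ i : ℕ in atTop, ∀ t ≤ crossTime β (2 ^ i), (ω t).1 < bF (2 * 2 ^ i + 1))
    (A : ℕ) : ∃ N : ℕ, ∀ n ≥ N, ∀ t, (ω t).1 = n → A * n ≤ t := by
  have h2 : Tendsto (fun i : ℕ => 2 ^ i) atTop atTop :=
    tendsto_pow_atTop_atTop_of_one_lt (by norm_num)
  obtain ⟨M, hM⟩ := eventually_atTop.1
    (hω.and (h2.eventually (eventually_mul_bF_le_crossTime hβ A)))
  refine ⟨bF (2 * 2 ^ M + 1), fun n hn t ht => ?_⟩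
  obtain ⟨i, hi, hin, hni⟩ := exists_le_lt_bF hn
  obtain ⟨h3, h4⟩ := hM i hi
  have h5 : crossTime β (2 ^ i) < t := by
    by_contra! hcon
    have := h3 t hcon
    omega
  have h6 : A * n ≤ A * bF (4 * 2 ^ i + 1) := Nat.mul_le_mul_left _ hni
  omega

lemma tendsto_speed_zero {ω : ℕ → V} (h0 : ∀ t, 0 ≤ (ω t).1)
    (hω : ∀ A : ℕ, ∃ N : ℕ, ∀ n ≥ N, ∀ t, (ω t).1 = n → A * n ≤ t) :
    Tendsto (fun t : ℕ => ((ω t).1 : ℝ) / t) atTop (nhds 0) := by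
  rw [Metric.tendsto_atTop]
  intro ε hε
  obtain ⟨A, hA⟩ := exists_nat_gt (1 / ε)
  obtain ⟨N, hN⟩ := hω A
  refine ⟨A * N + 1, fun t ht => ?_⟩
  obtain ⟨n, hn⟩ := Int.eq_ofNat_of_zero_le (h0 t)
  have hAn : A * n ≤ t := by
    rcases le_total N n with h | h
    · exact hN n h t hn
    · exact (Nat.mul_le_mul_left A h).trans (by omega)
  have ht0 : (0 : ℝ) < t := by
    have : 0 < t := by omega
    exact_mod_cast this
  have hAn' : (A : ℝ) * n ≤ t := by exact_mod_cast hAn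
  rw [hn, Real.dist_eq, sub_zero, Int.cast_natCast, abs_of_nonneg (by positivity),
    div_lt_iff₀ ht0]
  rw [div_lt_iff₀ hε] at hA
  have hn0 : (0 : ℝ) ≤ n := n.cast_nonneg
  rcases hn0.eq_or_lt with h | h
  · rw [← h]; positivity
  · nlinarith

lemma tendsto_hitTimeX_div_top {ω : ℕ → V}
    (hω : ∀ A : ℕ, ∃ N : ℕ, ∀ n ≥ N, ∀ t, (ω t).1 = n → A * n ≤ t) :
    Tendsto (fun n : ℕ => ((hitTimeX ω (n : ℤ) : ℝ≥0∞)) / (n : ℝ≥0∞)) atTop (nhds ⊤) := by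
  rw [ENNReal.tendsto_nhds_top_iff_nat]
  intro A
  obtain ⟨N, hN⟩ := hω (A + 1)
  filter_upwards [eventually_ge_atTop (N + 1)] with n hn
  have h1 : ((((A + 1) * n : ℕ) : ℕ∞)) ≤ hitTimeX ω n := by
    refine le_sInf ?_
    rintro _ ⟨t, rfl, ht⟩
    exact_mod_cast hN n (by omega) t ht
  have h2 : (((A + 1 : ℕ) : ℝ≥0∞)) * n ≤ (hitTimeX ω n : ℝ≥0∞) := by
    exact_mod_cast ENat.toENNReal_le.2 h1
  have h3 : ((A + 1 : ℕ) : ℝ≥0∞) ≤ (hitTimeX ω n : ℝ≥0∞) / n := by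
    rw [ENNReal.le_div_iff_mul_le]
    · exact h2
    · left; exact_mod_cast (by omega : n ≠ 0)
    · left; exact ENNReal.natCast_ne_top n
  refine lt_of_lt_of_le ?_ h3
  exact_mod_cast Nat.lt_succ_self A

/-- Theorem 1.1, zero speed regime (Section 6). For `1 < β < γ`, the β-biased random walk
on η = η(γ) started at a vertex on the main part of an order-1 branch a.s. has asymptotic
speed `0`; indeed, a.s. `U(x)/x → ∞` where `U(x)` is the first time the walk reaches
x-coordinate `x`. -/
theorem zero_speed_regime (γ : ℝ) (hγ : 1 < γ) (β : ℝ) (hβ1 : 1 < β) (hβγ : β < γ)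
    (l x : ℤ) (hl : Odd l) (hx : IsTip 1 x) (z : V) (hz : OnMainPart 1 l x z)
    (μ : Measure (ℕ → V)) (hμ : IsWalkLaw β (etaEdges γ) z μ) :
    ∀ᵐ ω ∂μ,
      Tendsto (fun t : ℕ => ((ω t).1 : ℝ) / t) atTop (nhds 0) ∧
        Tendsto (fun n : ℕ => ((hitTimeX ω (n : ℤ) : ℝ≥0∞)) / (n : ℝ≥0∞)) atTop
          (nhds ⊤) := by
  have hz0 : 0 ≤ z.1 := hx.nonneg.trans hz.2.1
  filter_upwards [ae_nonneg hβ1 hz0 hμ, ae_eventually_lt hγ hβ1 hβγ hμ hl hz.1] with ω h0 h1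
  have h2 := superlinear_of_eventually_lt hβ1 h1
  exact ⟨tendsto_speed_zero h0 h2, tendsto_hitTimeX_div_top h2⟩

end
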